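/- Pointwise-in-time decay for the Hartree equation: let φ be a rapidly decaying smooth solution of the Hartree equation with v(x) = χ(|x|)/|x|, where χ : [0,∞) → [0,∞) is smooth, compactly supported, and nonincreasing. Then there exists a constant C (depending on φ and v) such that for all t ≥ 1: ‖φ(t,·)‖_{L⁶(ℝ³)} ≤ C t^{−3/4} and ‖φ(t,·)‖_{L⁴(ℝ³)} ≤ C t^{−9/16}. -/

import Mathlib

open MeasureTheory

noncomputable section

/-- Three-dimensional Euclidean space. -/
abbrev E3 : Type := EuclideanSpace ℝ (Fin 3)

/-- Spatial Laplacian of a complex-valued function on `ℝ³`. -/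
def lapC (f : E3 → ℂ) (x : E3) : ℂ :=
  ∑ j : Fin 3, fderiv ℝ (fun y => fderiv ℝ f y (EuclideanSpace.single j 1)) x
    (EuclideanSpace.single j 1)

/-- Spatial Laplacian of a real-valued function on `ℝ³`. -/
def lapR (f : E3 → ℝ) (x : E3) : ℝ :=
  ∑ j : Fin 3, fderiv ℝ (fun y => fderiv ℝ f y (EuclideanSpace.single j 1)) x
    (EuclideanSpace.single j 1)

/-- The Hartree self-interaction potential `W = v * |f|²` (convolution on `ℝ³`). -/
def hartreeW (v : E3 → ℝ) (f : E3 → ℂ) (x : E3) : ℝ :=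
  MeasureTheory.convolution v (fun y => ‖f y‖ ^ 2) (ContinuousLinearMap.lsmul ℝ ℝ) volume x

/-- A rapidly decaying smooth solution of the Hartree equation
`i ∂ₜ φ + Δφ − (v * |φ|²) φ = 0`:  `φ` is smooth on space-time, every spatial
Schwartz-type seminorm of every space-time derivative of `φ` is bounded on compact
time intervals, and the equation holds pointwise. -/
structure IsHartreeSolution (v : E3 → ℝ) (φ : ℝ → E3 → ℂ) : Prop where
  smooth : ContDiff ℝ (⊤ : ℕ∞) (fun p : ℝ × E3 => φ p.1 p.2)
  decay : ∀ (k n : ℕ) (T : ℝ), ∃ C : ℝ, ∀ (t : ℝ) (x : E3), |t| ≤ T →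
    ‖x‖ ^ k * ‖iteratedFDeriv ℝ n (fun p : ℝ × E3 => φ p.1 p.2) (t, x)‖ ≤ C
  eqn : ∀ (t : ℝ) (x : E3),
    Complex.I * deriv (fun s => φ s x) t + lapC (φ t) x
      - (hartreeW v (φ t) x : ℂ) * φ t x = 0

/-- Mass density `ρ = ½|φ|²`. -/
def rhoH (φ : ℝ → E3 → ℂ) (t : ℝ) (x : E3) : ℝ := (1 / 2 : ℝ) * ‖φ t x‖ ^ 2

/-- The pseudoconformally rescaled profile `ψ_t(x) = e^{i|x|²/(4t)} φ(t,x)`. -/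
def psiH (φ : ℝ → E3 → ℂ) (t : ℝ) (x : E3) : ℂ :=
  Complex.exp (Complex.I * ((‖x‖ ^ 2 : ℝ) / (4 * t))) * φ t x

/-- The pseudoconformal energy
`E_c(t) = t² ∫ ( |∇ψ_t|² + W ρ ) dx`. -/
def EcH (v : E3 → ℝ) (φ : ℝ → E3 → ℂ) (t : ℝ) : ℝ :=
  t ^ 2 * ∫ x : E3,
    ((∑ j : Fin 3, ‖fderiv ℝ (psiH φ t) x (EuclideanSpace.single j 1)‖ ^ 2)
      + hartreeW v (φ t) x * rhoH φ t x)

/-- The pseudoconformal remainder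
`R_c(t) = t ∫∫ ( −4V(|x−y|) − 2|x−y| V′(|x−y|) ) ρ(t,x) ρ(t,y) dx dy`. -/
def RcH (V : ℝ → ℝ) (φ : ℝ → E3 → ℂ) (t : ℝ) : ℝ :=
  t * ∫ x : E3, ∫ y : E3,
    (-4 * V ‖x - y‖ - 2 * ‖x - y‖ * deriv V ‖x - y‖) * rhoH φ t x * rhoH φ t y

/-- The remainder for the rescaled pseudoconformal energy:
`R_cc(t) = ∫ |∇ψ_t|² dx − 2 ∫∫ ( V(|x−y|) + |x−y| V′(|x−y|) ) ρ(t,x) ρ(t,y) dx dy`. -/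
def RccH (V : ℝ → ℝ) (φ : ℝ → E3 → ℂ) (t : ℝ) : ℝ :=
  (∫ x : E3, ∑ j : Fin 3, ‖fderiv ℝ (psiH φ t) x (EuclideanSpace.single j 1)‖ ^ 2)
    - 2 * ∫ x : E3, ∫ y : E3,
        (V ‖x - y‖ + ‖x - y‖ * deriv V ‖x - y‖) * rhoH φ t x * rhoH φ t y

/-- The hypotheses on the cut-off `χ` in the Coulomb-type potential `v(x) = χ(|x|)/|x|`:
`χ` is smooth, nonnegative, compactly supported and nonincreasing on `[0,∞)`. -/
structure IsCutoff (χ : ℝ → ℝ) : Prop where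
  smooth : ContDiff ℝ (⊤ : ℕ∞) χ
  nonneg : ∀ r, 0 ≤ χ r
  compact_supp : HasCompactSupport χ
  mono : AntitoneOn χ (Set.Ici 0)

/-- A real function on space-time all of whose derivatives decay rapidly in space, locally
uniformly in time. -/
structure IsRapid (f : ℝ × E3 → ℝ) : Prop where
  smooth : ContDiff ℝ (⊤ : ℕ∞) f
  decay : ∀ (k n : ℕ) (T : ℝ), ∃ C : ℝ, ∀ (t : ℝ) (x : E3), |t| ≤ T →
    ‖x‖ ^ k * ‖iteratedFDeriv ℝ n f (t, x)‖ ≤ C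

/-- Directional derivative on space-time. -/
def dirD (e : ℝ × E3) (f : ℝ × E3 → ℝ) (p : ℝ × E3) : ℝ := fderiv ℝ f p e

namespace IsRapid

variable {f g : ℝ × E3 → ℝ}

theorem add (hf : IsRapid f) (hg : IsRapid g) : IsRapid (fun p => f p + g p) := by
  refine ⟨hf.smooth.add hg.smooth, fun k n T => ?_⟩
  obtain ⟨C, hC⟩ := hf.decay k n T
  obtain ⟨C', hC'⟩ := hg.decay k n T
  refine ⟨C + C', fun t x ht => ?_⟩
  have h : iteratedFDeriv ℝ n (fun p => f p + g p) (t, x)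
      = iteratedFDeriv ℝ n f (t, x) + iteratedFDeriv ℝ n g (t, x) :=
    iteratedFDeriv_add_apply ((hf.smooth.of_le (mod_cast le_top)).contDiffAt)
      ((hg.smooth.of_le (mod_cast le_top)).contDiffAt)
  rw [h]
  calc _ ≤ ‖x‖ ^ k * (‖iteratedFDeriv ℝ n f (t, x)‖ + ‖iteratedFDeriv ℝ n g (t, x)‖) := by
        gcongr; exact norm_add_le _ _
    _ ≤ C + C' := by rw [mul_add]; exact add_le_add (hC t x ht) (hC' t x ht)

theorem temperate_mul (hg : Function.HasTemperateGrowth g) (hf : IsRapid f) :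
    IsRapid (fun p => g p * f p) := by
  refine ⟨hg.1.mul hf.smooth, fun k n T => ?_⟩
  obtain ⟨m, C, hC0, hC⟩ := hg.norm_iteratedFDeriv_le_uniform n
  have hb : ∀ i : ℕ, ∃ B : ℝ, ∀ (t : ℝ) (x : E3), |t| ≤ T →
      ‖x‖ ^ k * (1 + ‖x‖) ^ m * ‖iteratedFDeriv ℝ i f (t, x)‖ ≤ B := by
    intro i
    obtain ⟨B, hB⟩ := hf.decay k i T
    obtain ⟨B', hB'⟩ := hf.decay (k + m) i T
    refine ⟨2 ^ m * (B + B'), fun t x ht => ?_⟩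
    have h1 := hB t x ht
    have h2 := hB' t x ht
    have h3 : (1 + ‖x‖) ^ m ≤ 2 ^ m * (1 + ‖x‖ ^ m) := by
      rcases le_total ‖x‖ 1 with hx | hx
      · calc (1 + ‖x‖) ^ m ≤ 2 ^ m := by gcongr; linarith
          _ ≤ _ := le_mul_of_one_le_right (by positivity) (by simp)
      · calc (1 + ‖x‖) ^ m ≤ (2 * ‖x‖) ^ m := by gcongr; linarith
          _ ≤ _ := by rw [mul_pow]; gcongr; linarith
    calc _ ≤ ‖x‖ ^ k * (2 ^ m * (1 + ‖x‖ ^ m)) * ‖iteratedFDeriv ℝ i f (t, x)‖ := by gcongr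
      _ = 2 ^ m * (‖x‖ ^ k * ‖iteratedFDeriv ℝ i f (t, x)‖
          + ‖x‖ ^ (k + m) * ‖iteratedFDeriv ℝ i f (t, x)‖) := by ring
      _ ≤ _ := by gcongr
  choose B hB using hb
  refine ⟨∑ i ∈ Finset.range (n + 1),
    (n.choose i : ℝ) * (C * (1 + |T|) ^ m * B (n - i)), fun t x ht => ?_⟩
  calc _ ≤ ‖x‖ ^ k * ∑ i ∈ Finset.range (n + 1), (n.choose i : ℝ) *
        ‖iteratedFDeriv ℝ i g (t, x)‖ * ‖iteratedFDeriv ℝ (n - i) f (t, x)‖ := by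
        gcongr
        exact norm_iteratedFDeriv_mul_le hg.1 hf.smooth (t, x) (mod_cast le_top)
    _ ≤ _ := by
        rw [Finset.mul_sum]
        refine Finset.sum_le_sum fun i hi => ?_
        have h1 := hC i (by simpa [Nat.lt_succ_iff] using hi) (t, x)
        have h2 := hB (n - i) t x ht
        have h3 : (1 + ‖(t, x)‖) ^ m ≤ (1 + |T|) ^ m * (1 + ‖x‖) ^ m := by
          rw [← mul_pow]
          gcongr
          have : |t| ≤ |T| := ht.trans (le_abs_self T)
          have h4 : ‖(t, x)‖ ≤ |T| + ‖x‖ := by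
            rw [Prod.norm_def, Real.norm_eq_abs]
            exact max_le (by linarith [norm_nonneg x]) (by linarith [abs_nonneg T])
          nlinarith [abs_nonneg T, norm_nonneg x]
        calc _ ≤ ‖x‖ ^ k * ((n.choose i : ℝ) * (C * ((1 + |T|) ^ m * (1 + ‖x‖) ^ m)) *
              ‖iteratedFDeriv ℝ (n - i) f (t, x)‖) := by
              gcongr
              exact h1.trans (by gcongr)
          _ = (n.choose i : ℝ) * (C * (1 + |T|) ^ m *
              (‖x‖ ^ k * (1 + ‖x‖) ^ m * ‖iteratedFDeriv ℝ (n - i) f (t, x)‖)) := by ring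
          _ ≤ _ := by gcongr

theorem mul (hf : IsRapid f) (hg : IsRapid g) : IsRapid (fun p => f p * g p) := by
  refine ⟨hf.smooth.mul hg.smooth, fun k n T => ?_⟩
  have h1 := fun i => hf.decay k i T
  have h2 := fun i => hg.decay 0 i T
  choose A hA using h1
  choose B hB using h2
  refine ⟨∑ i ∈ Finset.range (n + 1), (n.choose i : ℝ) * (A i * |B (n - i)|),
    fun t x ht => ?_⟩
  calc _ ≤ ‖x‖ ^ k * ∑ i ∈ Finset.range (n + 1), (n.choose i : ℝ) *
        ‖iteratedFDeriv ℝ i f (t, x)‖ * ‖iteratedFDeriv ℝ (n - i) g (t, x)‖ := by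
        gcongr
        exact norm_iteratedFDeriv_mul_le hf.smooth hg.smooth (t, x) (mod_cast le_top)
    _ ≤ _ := by
        rw [Finset.mul_sum]
        refine Finset.sum_le_sum fun i _ => ?_
        have h3 := hA i t x ht
        have h4 := (hB (n - i) t x ht).trans (le_abs_self _)
        have h5 : 0 ≤ A i := le_trans (by positivity) h3
        simp only [pow_zero, one_mul] at h4
        calc _ = (n.choose i : ℝ) * ((‖x‖ ^ k * ‖iteratedFDeriv ℝ i f (t, x)‖) *
              ‖iteratedFDeriv ℝ (n - i) g (t, x)‖) := by ring
          _ ≤ _ := by gcongr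

theorem const_mul (c : ℝ) (hf : IsRapid f) : IsRapid (fun p => c * f p) :=
  temperate_mul (g := fun _ => c) (.const c) hf

theorem dir (e : ℝ × E3) (hf : IsRapid f) : IsRapid (dirD e f) := by
  refine ⟨(hf.smooth.fderiv_right (m := (⊤ : ℕ∞)) (by simp)).clm_apply contDiff_const,
    fun k n T => ?_⟩
  obtain ⟨C, hC⟩ := hf.decay k (n + 1) T
  refine ⟨‖e‖ * C, fun t x ht => ?_⟩
  have h1 : ‖iteratedFDeriv ℝ n (dirD e f) (t, x)‖
      ≤ ‖e‖ * ‖iteratedFDeriv ℝ (n + 1) f (t, x)‖ := by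
    rw [← norm_iteratedFDeriv_fderiv]
    exact norm_iteratedFDeriv_clm_apply_const (N := (⊤ : ℕ∞))
      (hf.smooth.fderiv_right (by simp)).contDiffAt (mod_cast le_top)
  calc _ ≤ ‖x‖ ^ k * (‖e‖ * ‖iteratedFDeriv ℝ (n + 1) f (t, x)‖) := by gcongr
    _ = ‖e‖ * (‖x‖ ^ k * ‖iteratedFDeriv ℝ (n + 1) f (t, x)‖) := by ring
    _ ≤ _ := by gcongr; exact hC t x ht

theorem of_clm {Φ : ℝ × E3 → ℂ} (L : ℂ →L[ℝ] ℝ) (hs : ContDiff ℝ (⊤ : ℕ∞) Φ)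
    (hd : ∀ (k n : ℕ) (T : ℝ), ∃ C : ℝ, ∀ (t : ℝ) (x : E3), |t| ≤ T →
      ‖x‖ ^ k * ‖iteratedFDeriv ℝ n Φ (t, x)‖ ≤ C) : IsRapid (fun p => L (Φ p)) := by
  refine ⟨L.contDiff.comp hs, fun k n T => ?_⟩
  obtain ⟨C, hC⟩ := hd k n T
  refine ⟨‖L‖ * C, fun t x ht => ?_⟩
  have h1 : ‖iteratedFDeriv ℝ n (fun p => L (Φ p)) (t, x)‖
      ≤ ‖L‖ * ‖iteratedFDeriv ℝ n Φ (t, x)‖ :=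
    L.norm_iteratedFDeriv_comp_left (N := (⊤ : ℕ∞)) hs.contDiffAt (mod_cast le_top)
  calc _ ≤ ‖x‖ ^ k * (‖L‖ * ‖iteratedFDeriv ℝ n Φ (t, x)‖) := by gcongr
    _ = ‖L‖ * (‖x‖ ^ k * ‖iteratedFDeriv ℝ n Φ (t, x)‖) := by ring
    _ ≤ _ := by gcongr; exact hC t x ht

end IsRapid

/-- An integrable polynomial weight on `ℝ³`. -/
def weight (x : E3) : ℝ := (1 + ‖x‖) ^ (-4 : ℝ)

theorem weight_eq (x : E3) : weight x = ((1 + ‖x‖) ^ 4)⁻¹ := by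
  rw [weight, Real.rpow_neg (by positivity)]
  norm_cast

theorem weight_pos (x : E3) : 0 < weight x := by rw [weight_eq]; positivity

theorem weight_le_one (x : E3) : weight x ≤ 1 := by
  rw [weight_eq]
  exact inv_le_one_of_one_le₀ (one_le_pow₀ (by linarith [norm_nonneg x]))

theorem integrable_weight : Integrable weight :=
  integrable_one_add_norm (by simp; norm_num)

theorem le_weight {A B y : ℝ} (x : E3) (h0 : y ≤ A) (h1 : ‖x‖ ^ 4 * y ≤ B)
    (hy : 0 ≤ y) : y ≤ 16 * (A + B) * weight x := by
  have h2 : (1 + ‖x‖) ^ 4 ≤ 16 * (1 + ‖x‖ ^ 4) := by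
    nlinarith [sq_nonneg (‖x‖ - 1), sq_nonneg (‖x‖ ^ 2 - 1), norm_nonneg x,
      sq_nonneg (‖x‖ ^ 2 - ‖x‖)]
  rw [weight_eq, ← div_eq_mul_inv, le_div_iff₀ (by positivity)]
  nlinarith [mul_le_mul_of_nonneg_right h2 hy]

section dirD

variable {f g : ℝ × E3 → ℝ} {e e' : ℝ × E3} {p : ℝ × E3}

theorem dirD_mul (hf : DifferentiableAt ℝ f p) (hg : DifferentiableAt ℝ g p) :
    dirD e (fun q => f q * g q) p = dirD e f p * g p + f p * dirD e g p := by
  simp only [dirD]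
  rw [fderiv_fun_mul hf hg]
  simp
  ring

theorem dirD_add (hf : DifferentiableAt ℝ f p) (hg : DifferentiableAt ℝ g p) :
    dirD e (fun q => f q + g q) p = dirD e f p + dirD e g p := by
  simp only [dirD]
  rw [fderiv_fun_add hf hg]
  simp

theorem dirD_const_mul (c : ℝ) (hf : DifferentiableAt ℝ f p) :
    dirD e (fun q => c * f q) p = c * dirD e f p := by
  simp only [dirD]
  rw [fderiv_const_mul hf]
  simp

theorem dirD_comm (hf : ContDiff ℝ (⊤ : ℕ∞) f) :
    dirD e (dirD e' f) p = dirD e' (dirD e f) p := by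
  have h1 : DifferentiableAt ℝ (fderiv ℝ f) p :=
    (hf.fderiv_right (m := (⊤ : ℕ∞)) (by simp)).differentiable (by simp) p
  have h2 : ∀ a b : ℝ × E3, dirD a (dirD b f) p = fderiv ℝ (fderiv ℝ f) p a b := by
    intro a b
    have : fderiv ℝ (fun q => fderiv ℝ f q b) p = (fderiv ℝ (fderiv ℝ f) p).flip b := by
      rw [fderiv_clm_apply h1 (differentiableAt_const b)]
      simp
    simp only [dirD]
    change fderiv ℝ (fun q => fderiv ℝ f q b) p a = _
    rw [this]
    rfl
  rw [h2, h2]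
  exact (hf.contDiffAt.isSymmSndFDerivAt (by
    simpa using WithTop.coe_le_coe.2 (le_top : (2 : ℕ∞) ≤ ⊤))) e e'

end dirD

theorem hasDerivAt_time {F : Type*} [NormedAddCommGroup F] [NormedSpace ℝ F] {f : ℝ × E3 → F}
    {t : ℝ} {x : E3} (hf : DifferentiableAt ℝ f (t, x)) :
    HasDerivAt (fun s => f (s, x)) (fderiv ℝ f (t, x) (1, 0)) t :=
  hf.hasFDerivAt.comp_hasDerivAt t ((hasDerivAt_id t).prodMk (hasDerivAt_const t x))

theorem hasFDerivAt_space {F : Type*} [NormedAddCommGroup F] [NormedSpace ℝ F]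
    {f : ℝ × E3 → F} {t : ℝ} {x : E3} (hf : DifferentiableAt ℝ f (t, x)) :
    HasFDerivAt (fun y => f (t, y)) ((fderiv ℝ f (t, x)).comp (.inr ℝ ℝ E3)) x :=
  hf.hasFDerivAt.comp x ((hasFDerivAt_const t x).prodMk (hasFDerivAt_id x))

namespace IsRapid

variable {f g : ℝ × E3 → ℝ}

theorem differentiableAt (hf : IsRapid f) (p : ℝ × E3) : DifferentiableAt ℝ f p :=
  hf.smooth.differentiable (by simp) p

theorem bound (hf : IsRapid f) (T : ℝ) :
    ∃ C : ℝ, 0 ≤ C ∧ ∀ (t : ℝ) (x : E3), |t| ≤ T → |f (t, x)| ≤ C * weight x := by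
  obtain ⟨A, hA⟩ := hf.decay 0 0 T
  obtain ⟨B, hB⟩ := hf.decay 4 0 T
  refine ⟨16 * (|A| + |B|), by positivity, fun t x ht => ?_⟩
  have h1 := hA t x ht
  have h2 := hB t x ht
  simp only [norm_iteratedFDeriv_zero, Real.norm_eq_abs, pow_zero, one_mul] at h1 h2
  exact le_weight x (h1.trans (le_abs_self A)) (h2.trans (le_abs_self B)) (abs_nonneg _)

theorem continuous_slice (hf : IsRapid f) (t : ℝ) : Continuous (fun x => f (t, x)) :=
  hf.smooth.continuous.comp (by fun_prop)

theorem integrable (hf : IsRapid f) (t : ℝ) : Integrable (fun x => f (t, x)) := by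
  obtain ⟨C, -, hC⟩ := hf.bound |t|
  exact (integrable_weight.const_mul C).mono' (hf.continuous_slice t).aestronglyMeasurable
    (.of_forall fun x => hC t x le_rfl)

theorem hasDerivAt_integral (hf : IsRapid f) (t : ℝ) :
    HasDerivAt (fun s => ∫ x, f (s, x)) (∫ x, dirD (1, 0) f (t, x)) t := by
  obtain ⟨C, -, hC⟩ := (hf.dir (1, 0)).bound (|t| + 1)
  refine (hasDerivAt_integral_of_dominated_loc_of_deriv_le (F := fun s x => f (s, x))
    (F' := fun s x => dirD (1, 0) f (s, x)) (Metric.ball_mem_nhds t one_pos)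
    (.of_forall fun s => (hf.continuous_slice s).aestronglyMeasurable) (hf.integrable t)
    ((hf.dir _).continuous_slice t).aestronglyMeasurable
    (.of_forall fun x s hs => hC s x ?_) (integrable_weight.const_mul C)
    (.of_forall fun x s _ => hasDerivAt_time (hf.differentiableAt _))).2
  rw [Metric.mem_ball, Real.dist_eq] at hs
  have := abs_sub_abs_le_abs_sub s t
  linarith

theorem integral_dir_space (hf : IsRapid f) (e : E3) (t : ℝ) :
    ∫ x, dirD (0, e) f (t, x) = 0 := by
  have h := integral_smul_fderiv_eq_neg_fderiv_smul_of_integrable (𝕜 := ℝ) (μ := volume)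
    (f := fun _ : E3 => (1 : ℝ)) (g := fun x => f (t, x)) (v := e) (by simp) ?_
    (by simpa using hf.integrable t) (fun _ _ => by fun_prop)
    (fun x _ => (hasFDerivAt_space (hf.differentiableAt _)).differentiableAt)
  · simpa [dirD, (hasFDerivAt_space (hf.differentiableAt _)).fderiv] using h
  · have := (hf.dir (0, e)).integrable t
    simpa [dirD, (hasFDerivAt_space (hf.differentiableAt _)).fderiv] using this

end IsRapid

/-- Continuous functions dominated by a multiple of the weight. -/
structure IsWeightBounded (f : E3 → ℝ) : Prop where
  continuous : Continuous f
  bound : ∃ C : ℝ, ∀ x, |f x| ≤ C * weight x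

/-- The bilinear interaction form `∬ v(y) f(x - y) g(x) dx dy`. -/
def interaction (v f g : E3 → ℝ) : ℝ := ∫ p : E3 × E3, v p.2 * f (p.1 - p.2) * g p.1

namespace IsWeightBounded

variable {f g v : E3 → ℝ}

theorem nonneg_of_bound {C : ℝ} (h : ∀ x, |f x| ≤ C * weight x) : 0 ≤ C := by
  have := (abs_nonneg _).trans (h 0)
  exact nonneg_of_mul_nonneg_left this (weight_pos 0)

theorem integrable (hf : IsWeightBounded f) : Integrable f := by
  obtain ⟨C, hC⟩ := hf.bound
  exact (integrable_weight.const_mul C).mono' hf.continuous.aestronglyMeasurable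
    (.of_forall hC)

theorem exists_abs_le (hf : IsWeightBounded f) : ∃ C, ∀ x, |f x| ≤ C := by
  obtain ⟨C, hC⟩ := hf.bound
  exact ⟨C, fun x => (hC x).trans
    (mul_le_of_le_one_right (nonneg_of_bound hC) (weight_le_one x))⟩

theorem mul (hf : IsWeightBounded f) (hg : IsWeightBounded g) :
    IsWeightBounded (fun x => f x * g x) := by
  obtain ⟨A, hA⟩ := hf.exists_abs_le
  obtain ⟨B, hB⟩ := hg.bound
  refine ⟨hf.continuous.mul hg.continuous, A * B, fun x => ?_⟩
  rw [abs_mul, mul_assoc]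
  exact mul_le_mul (hA x) (hB x) (abs_nonneg _) ((abs_nonneg _).trans (hA x))

theorem integrable_interaction (hv : Integrable v) (hf : IsWeightBounded f)
    (hg : IsWeightBounded g) :
    Integrable (fun p : E3 × E3 => v p.2 * f (p.1 - p.2) * g p.1) := by
  obtain ⟨C, hC⟩ := hf.exists_abs_le
  have h1 : Integrable (fun p : E3 × E3 => g p.1 * v p.2) := hg.integrable.mul_prod hv
  have h2 : Integrable (fun p : E3 × E3 => f (p.1 - p.2) * (g p.1 * v p.2)) :=
    h1.bdd_mul (c := C) (hf.continuous.comp (by fun_prop)).aestronglyMeasurable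
      (.of_forall fun p => hC _)
  exact h2.congr (.of_forall fun p => by ring)

theorem interaction_eq (hv : Integrable v) (hf : IsWeightBounded f) (hg : IsWeightBounded g) :
    interaction v f g = ∫ x, (∫ y, v y * f (x - y)) * g x := by
  rw [interaction]
  change ∫ p : E3 × E3, _ ∂(volume.prod volume) = _
  rw [integral_prod _ (integrable_interaction hv hf hg)]
  simp_rw [integral_mul_const]

theorem interaction_eq' (hv : Integrable v) (hf : IsWeightBounded f) (hg : IsWeightBounded g) :
    interaction v f g = ∫ y, v y * ∫ x, f (x - y) * g x := by
  rw [interaction]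
  change ∫ p : E3 × E3, _ ∂(volume.prod volume) = _
  rw [integral_prod_symm _ (integrable_interaction hv hf hg)]
  simp_rw [mul_assoc, integral_const_mul]

theorem interaction_comm (hv : Integrable v) (hev : ∀ x, v (-x) = v x)
    (hf : IsWeightBounded f) (hg : IsWeightBounded g) :
    interaction v f g = interaction v g f := by
  rw [interaction_eq' hv hf hg, interaction_eq' hv hg hf, ← integral_neg_eq_self]
  congr 1
  ext y
  rw [hev, ← integral_sub_right_eq_self _ y]
  congr 2
  ext x
  simp [mul_comm]

theorem interaction_self_le (hv : Integrable v) (hv0 : ∀ᵐ x, 0 ≤ v x)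
    (hf : IsWeightBounded f) :
    interaction v f f ≤ (∫ y, v y) * ∫ x, f x ^ 2 := by
  have hsq : Integrable (fun x => f x ^ 2) := by
    simpa [sq] using (hf.mul hf).integrable
  have key : ∀ y, ∫ x, f (x - y) * f x ≤ ∫ x, f x ^ 2 := by
    intro y
    have h1 : Integrable (fun x => f (x - y) ^ 2) := hsq.comp_sub_right y
    have h3 : ∫ x, (f (x - y) ^ 2 + f x ^ 2) / 2 = ∫ x, f x ^ 2 := by
      rw [integral_div, integral_add h1 hsq,
        integral_sub_right_eq_self (fun x => f x ^ 2) y]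
      ring
    rw [← h3]
    obtain ⟨C, hC⟩ := hf.exists_abs_le
    refine integral_mono (hf.integrable.bdd_mul (c := C)
      (hf.continuous.comp (by fun_prop)).aestronglyMeasurable (.of_forall fun p => hC _))
      ((h1.add hsq).div_const 2) fun x => ?_
    simp only
    nlinarith [sq_nonneg (f (x - y) - f x)]
  rw [interaction_eq' hv hf hf, ← integral_mul_const]
  have h_int : Integrable (fun y => v y * ∫ x, f (x - y) * f x) := by
    have := (integrable_interaction hv hf hf).integral_prod_right
    simpa only [mul_assoc, integral_const_mul] using this
  refine integral_mono_ae h_int (hv.mul_const _) ?_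
  filter_upwards [hv0] with y hy
  exact mul_le_mul_of_nonneg_left (key y) hy

theorem interaction_self_nonneg (hv0 : ∀ᵐ x, 0 ≤ v x) (hf0 : ∀ x, 0 ≤ f x) :
    0 ≤ interaction v f f := by
  refine integral_nonneg_of_ae ?_
  have : ∀ᵐ p : E3 × E3 ∂(volume.prod volume), 0 ≤ v p.2 :=
    Measure.quasiMeasurePreserving_snd.ae hv0
  filter_upwards [this] with p hp
  exact mul_nonneg (mul_nonneg hp (hf0 _)) (hf0 _)

end IsWeightBounded

open IsWeightBounded in
/-- Differentiation of the quadratic interaction energy along a family of densities. -/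
theorem hasDerivAt_interaction {v : E3 → ℝ} (hv : Integrable v) (hev : ∀ x, v (-x) = v x)
    {m m' : ℝ → E3 → ℝ} {s₀ ε C : ℝ} (hε : 0 < ε)
    (hm : ∀ s ∈ Metric.ball s₀ ε, Continuous (m s))
    (hm' : Continuous (m' s₀))
    (hd : ∀ s ∈ Metric.ball s₀ ε, ∀ x, HasDerivAt (fun r => m r x) (m' s x) s)
    (hb : ∀ s ∈ Metric.ball s₀ ε, ∀ x, |m s x| ≤ C * weight x)
    (hb' : ∀ s ∈ Metric.ball s₀ ε, ∀ x, |m' s x| ≤ C * weight x) :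
    HasDerivAt (fun s => interaction v (m s) (m s)) (2 * interaction v (m s₀) (m' s₀)) s₀ := by
  have hs₀ : s₀ ∈ Metric.ball s₀ ε := Metric.mem_ball_self hε
  have hw : ∀ s ∈ Metric.ball s₀ ε, IsWeightBounded (m s) := fun s hs => ⟨hm s hs, C, hb s hs⟩
  have hw' : IsWeightBounded (m' s₀) := ⟨hm', C, hb' s₀ hs₀⟩
  have hC : 0 ≤ C := nonneg_of_bound (hb s₀ hs₀)
  have key := (hasDerivAt_integral_of_dominated_loc_of_deriv_le
    (μ := (volume : Measure (E3 × E3)))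
    (F := fun s (p : E3 × E3) => v p.2 * m s (p.1 - p.2) * m s p.1)
    (F' := fun s (p : E3 × E3) => v p.2 * m' s (p.1 - p.2) * m s p.1
      + v p.2 * m s (p.1 - p.2) * m' s p.1)
    (bound := fun p : E3 × E3 => 2 * C ^ 2 * (weight p.1 * |v p.2|))
    (Metric.ball_mem_nhds s₀ hε)
    ?_ (integrable_interaction hv (hw s₀ hs₀) (hw s₀ hs₀))
    ((integrable_interaction hv hw' (hw s₀ hs₀)).add
      (integrable_interaction hv (hw s₀ hs₀) hw')).aestronglyMeasurable
    ?_ ((integrable_weight.mul_prod hv.abs).const_mul _) ?_).2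
  · refine key.congr_deriv ?_
    rw [integral_add (integrable_interaction hv hw' (hw s₀ hs₀))
      (integrable_interaction hv (hw s₀ hs₀) hw')]
    change interaction v (m' s₀) (m s₀) + interaction v (m s₀) (m' s₀) = _
    rw [interaction_comm hv hev hw' (hw s₀ hs₀)]
    ring
  · filter_upwards [Metric.ball_mem_nhds s₀ hε] with s hs
    exact (integrable_interaction hv (hw s hs) (hw s hs)).aestronglyMeasurable
  · refine .of_forall fun p s hs => ?_
    have hle : ∀ x, C * weight x ≤ C := fun x => mul_le_of_le_one_right hC (weight_le_one x)
    have h1 := (hb s hs (p.1 - p.2)).trans (hle _)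
    have h2 := (hb' s hs (p.1 - p.2)).trans (hle _)
    have h3 := hb s hs p.1
    have h4 := hb' s hs p.1
    calc _ ≤ |v p.2| * |m' s (p.1 - p.2)| * |m s p.1|
          + |v p.2| * |m s (p.1 - p.2)| * |m' s p.1| := by
          rw [Real.norm_eq_abs]
          refine (abs_add_le _ _).trans ?_
          simp only [abs_mul, le_refl]
      _ ≤ |v p.2| * C * (C * weight p.1) + |v p.2| * C * (C * weight p.1) := by gcongr
      _ = _ := by ring
  · refine .of_forall fun p s hs => ?_
    have := ((hd s hs (p.1 - p.2)).const_mul (v p.2)).mul (hd s hs p.1)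
    exact this

namespace IsCutoff

variable {χ : ℝ → ℝ} {v : E3 → ℝ}

theorem integrable_potential (hχ : IsCutoff χ) (hv : ∀ x : E3, x ≠ 0 → v x = χ ‖x‖ / ‖x‖) :
    Integrable v := by
  have h1 : Integrable (fun x : E3 => (fun r : ℝ => χ r / r) ‖x‖) := by
    rw [integrable_fun_norm_addHaar (μ := (volume : Measure E3)) (f := fun r : ℝ => χ r / r)]
    have h2 : Integrable (fun r : ℝ => r * χ r) :=
      (continuous_id.mul hχ.smooth.continuous).integrable_of_hasCompactSupport
        hχ.compact_supp.mul_left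
    refine h2.integrableOn.congr_fun (fun r hr => ?_) measurableSet_Ioi
    have : r ≠ 0 := ne_of_gt hr
    simp
    field_simp
  refine h1.congr ?_
  filter_upwards [compl_mem_ae_iff.2 (measure_singleton (0 : E3))] with x hx
  exact (hv x hx).symm

theorem potential_neg (hv : ∀ x : E3, x ≠ 0 → v x = χ ‖x‖ / ‖x‖) (x : E3) : v (-x) = v x := by
  rcases eq_or_ne x 0 with rfl | hx
  · simp
  · rw [hv x hx, hv (-x) (neg_ne_zero.2 hx), norm_neg]

theorem potential_nonneg (hχ : IsCutoff χ) (hv : ∀ x : E3, x ≠ 0 → v x = χ ‖x‖ / ‖x‖)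
    {x : E3} (hx : x ≠ 0) : 0 ≤ v x := by
  rw [hv x hx]
  exact div_nonneg (hχ.nonneg _) (norm_nonneg _)

theorem ae_potential_nonneg (hχ : IsCutoff χ)
    (hv : ∀ x : E3, x ≠ 0 → v x = χ ‖x‖ / ‖x‖) : ∀ᵐ x, 0 ≤ v x := by
  filter_upwards [compl_mem_ae_iff.2 (measure_singleton (0 : E3))] with x hx
  exact potential_nonneg hχ hv hx

theorem mul_potential_le (hχ : IsCutoff χ) (hv : ∀ x : E3, x ≠ 0 → v x = χ ‖x‖ / ‖x‖)
    {l : ℝ} (hl : 1 ≤ l) {x : E3} (hx : x ≠ 0) : l * v x ≤ v (l⁻¹ • x) := by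
  have h0 : 0 < l := by linarith
  have hn : 0 < ‖x‖ := norm_pos_iff.2 hx
  rw [hv x hx, hv _ (smul_ne_zero (inv_ne_zero h0.ne') hx), norm_smul, norm_inv,
    Real.norm_of_nonneg h0.le]
  have h1 : l⁻¹ * ‖x‖ ≤ ‖x‖ := mul_le_of_le_one_left hn.le (inv_le_one_of_one_le₀ hl)
  have h2 : χ ‖x‖ ≤ χ (l⁻¹ * ‖x‖) :=
    hχ.mono (Set.mem_Ici.2 (by positivity)) (Set.mem_Ici.2 hn.le) h1
  calc l * (χ ‖x‖ / ‖x‖) = χ ‖x‖ / (l⁻¹ * ‖x‖) := by field_simp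
    _ ≤ _ := by gcongr

end IsCutoff

theorem weight_smul_le {l : ℝ} (hl : 1 / 2 ≤ l) (x : E3) : weight (l • x) ≤ 16 * weight x := by
  rw [weight_eq, weight_eq, norm_smul, Real.norm_of_nonneg (by linarith)]
  rw [← div_eq_mul_inv, inv_le_comm₀ (by positivity) (by positivity), inv_div,
    div_le_iff₀ (by norm_num)]
  have h : 1 + ‖x‖ ≤ 2 * (1 + l * ‖x‖) := by nlinarith [norm_nonneg x]
  calc (1 + ‖x‖) ^ 4 ≤ (2 * (1 + l * ‖x‖)) ^ 4 := by gcongr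
    _ = _ := by ring

theorem interaction_dilation (v f : E3 → ℝ) {l : ℝ} (hl : 0 < l) :
    interaction v (fun x => l ^ 3 * f (l • x)) (fun x => l ^ 3 * f (l • x))
      = interaction (fun x => v (l⁻¹ • x)) f f := by
  have h := Measure.integral_comp_smul (volume.prod volume : Measure (E3 × E3))
    (fun p : E3 × E3 => l ^ 6 * (v (l⁻¹ • p.2) * f (p.1 - p.2) * f p.1)) l
  simp only [Module.finrank_prod, finrank_euclideanSpace, Fintype.card_fin] at h
  rw [interaction, interaction]
  change _ = ∫ p : E3 × E3, _ ∂(volume.prod volume)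
  have h2 : |(l ^ (3 + 3))⁻¹| • (l ^ 6 * ∫ p : E3 × E3,
      v (l⁻¹ • p.2) * f (p.1 - p.2) * f p.1 ∂(volume.prod volume))
      = ∫ p : E3 × E3, v (l⁻¹ • p.2) * f (p.1 - p.2) * f p.1 ∂(volume.prod volume) := by
    rw [abs_of_pos (by positivity), smul_eq_mul]
    field_simp
  rw [← h2, ← integral_const_mul, ← h]
  change ∫ p : E3 × E3, _ ∂(volume.prod volume) = _
  congr 1
  ext p
  simp only [Prod.smul_fst, Prod.smul_snd, smul_smul, inv_mul_cancel₀ hl.ne', one_smul, smul_sub]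
  ring

theorem interaction_self_le_virial {χ : ℝ → ℝ} {v : E3 → ℝ} (hχ : IsCutoff χ)
    (hv : ∀ x : E3, x ≠ 0 → v x = χ ‖x‖ / ‖x‖) {f : E3 → ℝ} (hf0 : ∀ x, 0 ≤ f x)
    (hfd : Differentiable ℝ f) (hf : IsWeightBounded f)
    (hf' : IsWeightBounded (fun x => fderiv ℝ f x x)) :
    interaction v f f ≤ 2 * interaction v f (fun x => 3 * f x + fderiv ℝ f x x) := by
  obtain ⟨A, hA⟩ := hf.bound
  obtain ⟨B, hB⟩ := hf'.bound
  have hA0 := IsWeightBounded.nonneg_of_bound hA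
  have hB0 := IsWeightBounded.nonneg_of_bound hB
  have hvi := hχ.integrable_potential hv
  have hball : ∀ s ∈ Metric.ball (1 : ℝ) (1 / 2), 1 / 2 ≤ s ∧ s ≤ 3 / 2 := by
    intro s hs
    rw [Metric.mem_ball, Real.dist_eq, abs_lt] at hs
    constructor <;> linarith
  have hder := hasDerivAt_interaction hvi (IsCutoff.potential_neg hv)
    (m := fun l x => l ^ 3 * f (l • x))
    (m' := fun l x => l ^ 2 * (3 * f (l • x) + fderiv ℝ f (l • x) (l • x)))
    (s₀ := 1) (ε := 1 / 2) (C := 100 * (3 * A + B)) (by norm_num)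
    (fun s _ => continuous_const.mul (hf.continuous.comp (by fun_prop)))
    (by simpa using (hf.continuous.const_mul 3).fun_add hf'.continuous) ?_ ?_ ?_
  · have hinner : HasDerivAt (fun l : ℝ => l * interaction v f f) (interaction v f f) 1 := by
      simpa using (hasDerivAt_id (1 : ℝ)).mul_const (interaction v f f)
    have hsub := hder.sub hinner
    simp only [one_smul, one_pow, one_mul] at hsub
    have hnn : ∀ l : ℝ, 1 ≤ l → 0 ≤ interaction v (fun x => l ^ 3 * f (l • x))
        (fun x => l ^ 3 * f (l • x)) - l * interaction v f f := by
      intro l hl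
      have h0 : 0 < l := by linarith
      rw [interaction_dilation v f h0, sub_nonneg, interaction, ← integral_const_mul]
      have hvl : Integrable (fun x : E3 => v (l⁻¹ • x)) := hvi.comp_smul (inv_ne_zero h0.ne')
      refine integral_mono_ae ((IsWeightBounded.integrable_interaction hvi hf hf).const_mul l)
        (IsWeightBounded.integrable_interaction hvl hf hf) ?_
      have h0 : ∀ᵐ p : E3 × E3 ∂(volume.prod volume), p.2 ≠ 0 :=
        Measure.quasiMeasurePreserving_snd.ae
          (compl_mem_ae_iff.2 (measure_singleton (0 : E3)) : ∀ᵐ x : E3, x ≠ 0)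
      filter_upwards [h0] with p hp
      have := IsCutoff.mul_potential_le hχ hv hl hp
      calc l * (v p.2 * f (p.1 - p.2) * f p.1) = (l * v p.2) * f (p.1 - p.2) * f p.1 := by ring
        _ ≤ _ := by gcongr <;> apply hf0
    have hmono : nhdsWithin (1 : ℝ) (Set.Ioi 1) ≤ nhdsWithin 1 {1}ᶜ :=
      nhdsWithin_mono 1 fun x (hx : (1 : ℝ) < x) => ne_of_gt hx
    have hge : 0 ≤ 2 * interaction v f (fun x => 3 * f x + fderiv ℝ f x x)
        - interaction v f f := by
      refine ge_of_tendsto (hsub.tendsto_slope.mono_left hmono) ?_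
      filter_upwards [self_mem_nhdsWithin] with l hl
      have hl' : (1 : ℝ) < l := hl
      rw [slope_def_field]
      refine div_nonneg ?_ (by linarith)
      have := hnn l hl'.le
      simpa using this
    linarith
  · intro s hs x
    have h1 : HasDerivAt (fun l : ℝ => f (l • x)) (fderiv ℝ f (s • x) x) s := by
      have := (hfd (s • x)).hasFDerivAt.comp_hasDerivAt s ((hasDerivAt_id s).smul_const x)
      simpa [Function.comp_def] using this
    have h2 := (hasDerivAt_pow 3 s).mul h1
    refine h2.congr_deriv ?_
    simp
    ring
  · intro s hs x
    obtain ⟨h1, h2⟩ := hball s hs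
    have h3 : s ^ 3 ≤ 4 := by
      calc s ^ 3 ≤ (3 / 2) ^ 3 := by gcongr
        _ ≤ 4 := by norm_num
    have hw := weight_smul_le h1 x
    have hwp := weight_pos x
    rw [abs_mul, abs_of_nonneg (by positivity)]
    calc s ^ 3 * |f (s • x)| ≤ 4 * (A * (16 * weight x)) := by
          gcongr
          exact (hA _).trans (by gcongr)
      _ ≤ _ := by nlinarith [mul_nonneg hA0 hwp.le, mul_nonneg hB0 hwp.le]
  · intro s hs x
    obtain ⟨h1, h2⟩ := hball s hs
    have h3 : s ^ 2 ≤ 3 := by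
      calc s ^ 2 ≤ (3 / 2) ^ 2 := by gcongr
        _ ≤ 3 := by norm_num
    have hw := weight_smul_le h1 x
    have hwp := weight_pos x
    rw [abs_mul, abs_of_nonneg (by positivity)]
    have h4 : |3 * f (s • x) + fderiv ℝ f (s • x) (s • x)| ≤ (3 * A + B) * (16 * weight x) := by
      have h5 := hA (s • x)
      have h6 := hB (s • x)
      calc _ ≤ 3 * |f (s • x)| + |fderiv ℝ f (s • x) (s • x)| := by
            refine (abs_add_le _ _).trans ?_
            rw [abs_mul, abs_of_nonneg (by norm_num : (0 : ℝ) ≤ 3)]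
        _ ≤ (3 * A + B) * weight (s • x) := by linarith
        _ ≤ _ := by gcongr
    calc _ ≤ 3 * ((3 * A + B) * (16 * weight x)) := by gcongr
      _ ≤ _ := by nlinarith [mul_nonneg hA0 hwp.le, mul_nonneg hB0 hwp.le]

/-- The Gagliardo–Nirenberg–Sobolev inequality without compact support. -/
theorem eLpNorm_six_le_eLpNorm_fderiv {u : E3 → ℂ} (hu : ContDiff ℝ 1 u)
    (hu2 : MemLp u 2 volume) :
    eLpNorm u 6 volume ≤ SNormLESNormFDerivOfEqConst ℂ (volume : Measure E3) 2
      * eLpNorm (fderiv ℝ u) 2 volume := by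
  let η : ContDiffBump (0 : E3) := ⟨1, 2, one_pos, one_lt_two⟩
  have hη : ContDiff ℝ 1 η := η.contDiff
  obtain ⟨D, hD⟩ := (hη.continuous_fderiv one_ne_zero).norm.bddAbove_range_of_hasCompactSupport
    ((η.hasCompactSupport.fderiv ℝ).norm)
  have hD' : ∀ x, ‖fderiv ℝ η x‖ ≤ D := fun x => hD ⟨x, rfl⟩
  have hD0 : 0 ≤ D := (norm_nonneg _).trans (hD' 0)
  let δ : ℕ → ℝ := fun n => ((n : ℝ) + 1)⁻¹
  have hδ : ∀ n, 0 < δ n := fun n => by positivity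
  have hδt : Filter.Tendsto δ Filter.atTop (nhds 0) := by
    simpa [δ, one_div] using tendsto_one_div_add_atTop_nhds_zero_nat (𝕜 := ℝ)
  let U : ℕ → E3 → ℂ := fun n x => η (δ n • x) • u x
  have hηn : ∀ n, ContDiff ℝ 1 (fun x : E3 => η (δ n • x)) := fun n =>
    hη.comp (contDiff_const_smul _)
  have hU : ∀ n, ContDiff ℝ 1 (U n) := fun n => (hηn n).smul hu
  have hUc : ∀ n, HasCompactSupport (U n) := fun n =>
    (η.hasCompactSupport.comp_smul (hδ n).ne').smul_right
  have hfd : ∀ n x, ‖fderiv ℝ (U n) x‖ ≤ ‖fderiv ℝ u x‖ + δ n * D * ‖u x‖ := by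
    intro n x
    have h1 : HasFDerivAt (fun x : E3 => η (δ n • x))
        ((fderiv ℝ η (δ n • x)).comp (δ n • ContinuousLinearMap.id ℝ E3)) x :=
      ((hη.differentiable one_ne_zero) _).hasFDerivAt.comp x ((hasFDerivAt_id x).const_smul (δ n))
    have h2 := h1.smul ((hu.differentiable one_ne_zero) x).hasFDerivAt
    rw [show fderiv ℝ (U n) x = _ from h2.fderiv]
    refine (norm_add_le _ _).trans (add_le_add ?_ ?_)
    · rw [norm_smul, Real.norm_of_nonneg η.nonneg]
      exact mul_le_of_le_one_left (norm_nonneg _) η.le_one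
    · rw [ContinuousLinearMap.norm_smulRight_apply]
      gcongr
      rw [ContinuousLinearMap.comp_smul, ContinuousLinearMap.comp_id, norm_smul,
        Real.norm_of_nonneg (hδ n).le]
      gcongr
      exact hD' _
  set S := SNormLESNormFDerivOfEqConst ℂ (volume : Measure E3) 2
  set A := eLpNorm (fderiv ℝ u) 2 volume
  set B := eLpNorm u 2 volume
  have hbound : ∀ n, eLpNorm (U n) 6 volume ≤ S * (A + ENNReal.ofReal (δ n * D) * B) := by
    intro n
    have h1 := eLpNorm_le_eLpNorm_fderiv_of_eq (μ := (volume : Measure E3)) (hU n) (hUc n)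
      (p := 2) (p' := 6) (by norm_num) (by simp) (by simp; norm_num)
    refine h1.trans (mul_le_mul' (le_of_eq (by simp [S])) ?_)
    have h2 : eLpNorm (fderiv ℝ (U n)) 2 volume
        ≤ eLpNorm (fun x => ‖fderiv ℝ u x‖ + δ n * D * ‖u x‖) 2 volume :=
      eLpNorm_mono fun x => (hfd n x).trans (le_abs_self _)
    refine h2.trans ?_
    have h3 := eLpNorm_add_le (μ := (volume : Measure E3)) (p := 2)
      (hu.continuous_fderiv one_ne_zero).norm.aestronglyMeasurable
      (hu.continuous.norm.const_mul (δ n * D)).aestronglyMeasurable (by norm_num)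
    refine h3.trans ?_
    rw [eLpNorm_norm]
    gcongr
    have h4 := eLpNorm_const_smul (δ n * D) (fun x => ‖u x‖) 2 (volume : Measure E3)
    rw [eLpNorm_norm, Real.enorm_of_nonneg (mul_nonneg (hδ n).le hD0)] at h4
    exact h4.le
  have hlim := Lp.eLpNorm_lim_le_liminf_eLpNorm (μ := (volume : Measure E3)) (p := 6)
    (fun n => (hU n).continuous.aestronglyMeasurable) u (.of_forall fun x => by
      have h1 : Filter.Tendsto (fun n => δ n • x) Filter.atTop (nhds (0 : E3)) := by
        simpa using hδt.smul_const x
      have h2 := (hη.continuous.tendsto 0).comp h1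
      have h3 : η 0 = 1 := η.one_of_mem_closedBall (by simp [η])
      rw [h3] at h2
      simpa [U] using h2.smul_const (u x))
  refine hlim.trans ?_
  have ht : Filter.Tendsto (fun n => (S : ENNReal) * (A + ENNReal.ofReal (δ n * D) * B))
      Filter.atTop (nhds (S * (A + 0 * B))) := by
    refine ENNReal.Tendsto.const_mul (tendsto_const_nhds.add
      (ENNReal.Tendsto.mul_const ?_ (Or.inr hu2.2.ne))) (Or.inr ENNReal.coe_ne_top)
    simpa using ENNReal.tendsto_ofReal (hδt.mul_const D)
  have h5 := (Filter.liminf_le_liminf (.of_forall hbound)).trans_eq ht.liminf_eq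
  simpa using h5

theorem norm_clm_sq_le_sum (L : E3 →L[ℝ] ℂ) :
    ‖L‖ ≤ Real.sqrt (∑ j : Fin 3, ‖L (EuclideanSpace.single j 1)‖ ^ 2) := by
  refine L.opNorm_le_bound (Real.sqrt_nonneg _) fun x => ?_
  have hx : x = ∑ j : Fin 3, x j • EuclideanSpace.single j (1 : ℝ) := by
    ext i
    simp [Finset.sum_apply, Pi.single_apply]
  conv_lhs => rw [hx]
  rw [map_sum, EuclideanSpace.norm_eq]
  simp only [map_smul]
  calc _ ≤ ∑ j : Fin 3, ‖L (EuclideanSpace.single j 1)‖ * ‖x j‖ := by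
        refine (norm_sum_le _ _).trans (Finset.sum_le_sum fun j _ => ?_)
        rw [norm_smul, mul_comm]
    _ ≤ _ := Real.sum_mul_le_sqrt_mul_sqrt _ _ _

theorem exists_eLpNorm_six_le : ∃ C : ℝ, 0 ≤ C ∧ ∀ u : E3 → ℂ, ContDiff ℝ 1 u →
    MemLp u 2 volume →
    Integrable (fun x => ∑ j : Fin 3, ‖fderiv ℝ u x (EuclideanSpace.single j 1)‖ ^ 2) →
    eLpNorm u 6 volume ≤ ENNReal.ofReal (C *
      (∫ x, ∑ j : Fin 3, ‖fderiv ℝ u x (EuclideanSpace.single j 1)‖ ^ 2) ^ (1 / 2 : ℝ)) := by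
  refine ⟨SNormLESNormFDerivOfEqConst ℂ (volume : Measure E3) 2, NNReal.coe_nonneg _,
    fun u hu hu2 h_int => ?_⟩
  refine (eLpNorm_six_le_eLpNorm_fderiv hu hu2).trans ?_
  rw [ENNReal.ofReal_mul (NNReal.coe_nonneg _), ENNReal.ofReal_coe_nnreal]
  gcongr
  set q : E3 → ℝ := fun x => ∑ j : Fin 3, ‖fderiv ℝ u x (EuclideanSpace.single j 1)‖ ^ 2
  have hq : ∀ x, 0 ≤ q x := fun x => Finset.sum_nonneg fun _ _ => by positivity
  have hm : MemLp (fun x => Real.sqrt (q x)) 2 volume := by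
    rw [memLp_two_iff_integrable_sq]
    · simpa [Real.sq_sqrt (hq _)] using h_int
    · exact (Real.continuous_sqrt.comp_aestronglyMeasurable h_int.1)
  refine (eLpNorm_mono (g := fun x => Real.sqrt (q x)) fun x =>
    (norm_clm_sq_le_sum _).trans (le_abs_self _)).trans ?_
  rw [hm.eLpNorm_eq_integral_rpow_norm (by norm_num) (by norm_num)]
  have : ∀ x, ‖Real.sqrt (q x)‖ ^ (ENNReal.toReal 2) = q x := by
    intro x
    rw [Real.norm_of_nonneg (Real.sqrt_nonneg _)]
    simp [Real.sq_sqrt (hq x)]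
  simp [Real.sq_sqrt (hq _), q]

/-- The unit time direction. -/
def dirT : ℝ × E3 := (1, 0)

/-- The `j`-th unit space direction. -/
def dirX (j : Fin 3) : ℝ × E3 := (0, EuclideanSpace.single j 1)

/-- The `j`-th space coordinate. -/
def coordX (j : Fin 3) (p : ℝ × E3) : ℝ := p.2 j

/-- Smooth real functions on space-time. -/
def IsSmooth (f : ℝ × E3 → ℝ) : Prop := ContDiff ℝ (⊤ : ℕ∞) f

namespace IsSmooth

variable {f g : ℝ × E3 → ℝ}

theorem mul (hf : IsSmooth f) (hg : IsSmooth g) : IsSmooth (fun p => f p * g p) :=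
  ContDiff.mul hf hg

theorem add (hf : IsSmooth f) (hg : IsSmooth g) : IsSmooth (fun p => f p + g p) :=
  ContDiff.add hf hg

theorem const_mul (c : ℝ) (hf : IsSmooth f) : IsSmooth (fun p => c * f p) :=
  ContDiff.mul contDiff_const hf

theorem dir (hf : IsSmooth f) (e : ℝ × E3) : IsSmooth (dirD e f) :=
  (ContDiff.fderiv_right (m := (⊤ : ℕ∞)) hf (by simp)).clm_apply contDiff_const

theorem coordX (j : Fin 3) : IsSmooth (coordX j) := by
  unfold IsSmooth _root_.coordX
  fun_prop

theorem differentiableAt (hf : IsSmooth f) (p : ℝ × E3) : DifferentiableAt ℝ f p :=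
  ContDiff.differentiable hf (by simp) p

theorem dirD_mul (hf : IsSmooth f) (hg : IsSmooth g) (e : ℝ × E3) :
    dirD e (fun q => f q * g q) = fun p => dirD e f p * g p + f p * dirD e g p :=
  funext fun p => _root_.dirD_mul (hf.differentiableAt p) (hg.differentiableAt p)

theorem dirD_add (hf : IsSmooth f) (hg : IsSmooth g) (e : ℝ × E3) :
    dirD e (fun q => f q + g q) = fun p => dirD e f p + dirD e g p :=
  funext fun p => _root_.dirD_add (hf.differentiableAt p) (hg.differentiableAt p)

theorem dirD_const_mul (hf : IsSmooth f) (c : ℝ) (e : ℝ × E3) :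
    dirD e (fun q => c * f q) = fun p => c * dirD e f p :=
  funext fun p => _root_.dirD_const_mul c (hf.differentiableAt p)

theorem dirD_dirT_dirX (hf : IsSmooth f) (j : Fin 3) :
    dirD dirT (dirD (dirX j) f) = dirD (dirX j) (dirD dirT f) :=
  funext fun _ => dirD_comm hf

theorem dirD_one_zero (hf : IsSmooth f) :
    dirD (dirX 1) (dirD (dirX 0) f) = dirD (dirX 0) (dirD (dirX 1) f) :=
  funext fun _ => dirD_comm hf

theorem dirD_two_zero (hf : IsSmooth f) :
    dirD (dirX 2) (dirD (dirX 0) f) = dirD (dirX 0) (dirD (dirX 2) f) :=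
  funext fun _ => dirD_comm hf

theorem dirD_two_one (hf : IsSmooth f) :
    dirD (dirX 2) (dirD (dirX 1) f) = dirD (dirX 1) (dirD (dirX 2) f) :=
  funext fun _ => dirD_comm hf

end IsSmooth

theorem dirD_coordX (e : ℝ × E3) (k : Fin 3) (p : ℝ × E3) : dirD e (coordX k) p = e.2 k := by
  have h : HasFDerivAt (coordX k)
      ((EuclideanSpace.proj k : E3 →L[ℝ] ℝ).comp
        (ContinuousLinearMap.snd ℝ ℝ E3)) p :=
    ((EuclideanSpace.proj k : E3 →L[ℝ] ℝ).comp (ContinuousLinearMap.snd ℝ ℝ E3)).hasFDerivAt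
  rw [dirD, h.fderiv]
  simp

theorem dirD_dirT_coordX (k : Fin 3) (p : ℝ × E3) : dirD dirT (coordX k) p = 0 := by
  simp [dirD_coordX, dirT]

theorem dirD_dirX_coordX (j k : Fin 3) (p : ℝ × E3) :
    dirD (dirX j) (coordX k) p = if k = j then 1 else 0 := by
  simp [dirD_coordX, dirX]

theorem IsRapid.isSmooth {f : ℝ × E3 → ℝ} (hf : IsRapid f) : IsSmooth f := hf.smooth

theorem IsRapid.coordX_mul {f : ℝ × E3 → ℝ} (hf : IsRapid f) (j : Fin 3) :
    IsRapid (fun p => coordX j p * f p) := by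
  refine hf.temperate_mul (g := coordX j) ?_
  exact ((EuclideanSpace.proj j : E3 →L[ℝ] ℝ).comp
        (ContinuousLinearMap.snd ℝ ℝ E3)).hasTemperateGrowth

/-- Differentiation of a spatial integral modulo a spatial divergence. -/
theorem IsRapid.hasDerivAt_integral_of_flux {f : ℝ × E3 → ℝ} {F : Fin 3 → ℝ × E3 → ℝ}
    {g : E3 → ℝ} {t : ℝ} (hf : IsRapid f) (hF : ∀ j, IsRapid (F j))
    (h : ∀ x, dirD dirT f (t, x) = g x + (dirD (dirX 0) (F 0) (t, x)
      + dirD (dirX 1) (F 1) (t, x) + dirD (dirX 2) (F 2) (t, x))) :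
    Integrable g ∧ HasDerivAt (fun s => ∫ x, f (s, x)) (∫ x, g x) t := by
  have hi := fun j => ((hF j).dir (dirX j)).integrable t
  have hft := (hf.dir dirT).integrable t
  have hsum := ((hi 0).add (hi 1)).add (hi 2)
  have hg : g = fun x => dirD dirT f (t, x) - (dirD (dirX 0) (F 0) (t, x)
      + dirD (dirX 1) (F 1) (t, x) + dirD (dirX 2) (F 2) (t, x)) := by
    ext x
    rw [h x]
    ring
  have hgi : Integrable g := by rw [hg]; exact hft.sub hsum
  refine ⟨hgi, (hf.hasDerivAt_integral t).congr_deriv ?_⟩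
  change ∫ x, dirD dirT f (t, x) = _
  have hz := fun j => (hF j).integral_dir_space (EuclideanSpace.single j 1) t
  change ∀ j, ∫ x, dirD (dirX j) (F j) (t, x) = 0 at hz
  have h01 := (hi 0).add (hi 1)
  have e1 := integral_add h01 (hi 2)
  have e2 := integral_add (hi 0) (hi 1)
  have e0 := integral_add hgi hsum
  simp only [Pi.add_apply] at e0 e1
  rw [integral_congr_ae (.of_forall h), e0, e1, e2, hz, hz, hz]
  simp

/-- The real and imaginary parts of a Schrödinger equation with real potential `W`. -/
structure IsSchrodingerPair (a b W : ℝ × E3 → ℝ) : Prop where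
  rapid_re : IsRapid a
  rapid_im : IsRapid b
  eq_re : ∀ p, dirD dirT a p = -(dirD (dirX 0) (dirD (dirX 0) b) p
    + dirD (dirX 1) (dirD (dirX 1) b) p + dirD (dirX 2) (dirD (dirX 2) b) p) + W p * b p
  eq_im : ∀ p, dirD dirT b p = (dirD (dirX 0) (dirD (dirX 0) a) p
    + dirD (dirX 1) (dirD (dirX 1) a) p + dirD (dirX 2) (dirD (dirX 2) a) p) - W p * a p

/-- The density `a² + b²`. -/
def dens (a b : ℝ × E3 → ℝ) (p : ℝ × E3) : ℝ := a p * a p + b p * b p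

/-- The momentum density `a ∂ⱼb - b ∂ⱼa`. -/
def current (a b : ℝ × E3 → ℝ) (j : Fin 3) (p : ℝ × E3) : ℝ :=
  a p * dirD (dirX j) b p + (-1) * (b p * dirD (dirX j) a p)

/-- The real part of `∂ⱼφ̄ ∂ₖφ`. -/
def stress (a b : ℝ × E3 → ℝ) (j k : Fin 3) (p : ℝ × E3) : ℝ :=
  dirD (dirX j) a p * dirD (dirX k) a p + dirD (dirX j) b p * dirD (dirX k) b p

/-- The kinetic energy density. -/
def kinetic (a b : ℝ × E3 → ℝ) (p : ℝ × E3) : ℝ :=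
  stress a b 0 0 p + stress a b 1 1 p + stress a b 2 2 p

/-- The density of the second moment. -/
def moment (a b : ℝ × E3 → ℝ) (p : ℝ × E3) : ℝ :=
  coordX 0 p * (coordX 0 p * dens a b p) + coordX 1 p * (coordX 1 p * dens a b p)
    + coordX 2 p * (coordX 2 p * dens a b p)

/-- The density of the radial momentum. -/
def radial (a b : ℝ × E3 → ℝ) (p : ℝ × E3) : ℝ :=
  coordX 0 p * current a b 0 p + coordX 1 p * current a b 1 p + coordX 2 p * current a b 2 p

section rapid

variable {a b : ℝ × E3 → ℝ}

theorem isRapid_dens (ha : IsRapid a) (hb : IsRapid b) : IsRapid (dens a b) :=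
  (ha.mul ha).add (hb.mul hb)

theorem isRapid_current (ha : IsRapid a) (hb : IsRapid b) (j : Fin 3) :
    IsRapid (current a b j) :=
  (ha.mul (hb.dir _)).add ((hb.mul (ha.dir _)).const_mul _)

theorem isRapid_stress (ha : IsRapid a) (hb : IsRapid b) (j k : Fin 3) :
    IsRapid (stress a b j k) :=
  ((ha.dir _).mul (ha.dir _)).add ((hb.dir _).mul (hb.dir _))

theorem isRapid_kinetic (ha : IsRapid a) (hb : IsRapid b) : IsRapid (kinetic a b) :=
  ((isRapid_stress ha hb 0 0).add (isRapid_stress ha hb 1 1)).add (isRapid_stress ha hb 2 2)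

theorem isRapid_moment (ha : IsRapid a) (hb : IsRapid b) : IsRapid (moment a b) := by
  have h := fun j => ((isRapid_dens ha hb).coordX_mul j).coordX_mul j
  exact ((h 0).add (h 1)).add (h 2)

theorem isRapid_radial (ha : IsRapid a) (hb : IsRapid b) : IsRapid (radial a b) := by
  have h := fun j => (isRapid_current ha hb j).coordX_mul j
  exact ((h 0).add (h 1)).add (h 2)

end rapid

namespace IsSchrodingerPair

variable {a b W : ℝ × E3 → ℝ}

theorem hasDerivAt_mass (h : IsSchrodingerPair a b W) (t : ℝ) :
    HasDerivAt (fun s => ∫ x, dens a b (s, x)) 0 t := by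
  have ha := h.rapid_re
  have hb := h.rapid_im
  have has := ha.isSmooth
  have hbs := hb.isSmooth
  have key := (IsRapid.hasDerivAt_integral_of_flux (t := t) (isRapid_dens ha hb)
    (F := fun j p => (-2) * current a b j p) (g := fun _ => 0)
    (fun j => (isRapid_current ha hb j).const_mul _) fun x => ?_).2
  · simpa using key
  · unfold dens current
    simp (maxDischargeDepth := 20) only [IsSmooth.dirD_mul, IsSmooth.dirD_add,
      IsSmooth.dirD_const_mul, IsSmooth.mul, IsSmooth.add, IsSmooth.const_mul, IsSmooth.dir,
      has, hbs]
    linear_combination 2 * a (t, x) * h.eq_re (t, x) + 2 * b (t, x) * h.eq_im (t, x)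

theorem hasDerivAt_moment (h : IsSchrodingerPair a b W) (t : ℝ) :
    HasDerivAt (fun s => ∫ x, moment a b (s, x)) (4 * ∫ x, radial a b (t, x)) t := by
  have ha := h.rapid_re
  have hb := h.rapid_im
  have has := ha.isSmooth
  have hbs := hb.isSmooth
  have key := (IsRapid.hasDerivAt_integral_of_flux (t := t) (isRapid_moment ha hb)
    (F := fun j p => (-2) * (coordX 0 p * (coordX 0 p * current a b j p)
      + coordX 1 p * (coordX 1 p * current a b j p) + coordX 2 p * (coordX 2 p * current a b j p)))
    (g := fun x => 4 * radial a b (t, x))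
    (fun j => ?_) fun x => ?_).2
  · rwa [integral_const_mul] at key
  · have hc := fun k => ((isRapid_current ha hb j).coordX_mul k).coordX_mul k
    exact (((hc 0).add (hc 1)).add (hc 2)).const_mul _
  · unfold moment radial dens current
    simp (maxDischargeDepth := 20) only [IsSmooth.dirD_mul, IsSmooth.dirD_add,
      IsSmooth.dirD_const_mul, IsSmooth.mul, IsSmooth.add, IsSmooth.const_mul, IsSmooth.dir,
      has, hbs, IsSmooth.coordX,
      dirD_dirT_coordX, dirD_dirX_coordX, Fin.reduceEq, if_true, if_false]
    linear_combination (coordX 0 (t, x) ^ 2 + coordX 1 (t, x) ^ 2 + coordX 2 (t, x) ^ 2) *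
      (2 * a (t, x) * h.eq_re (t, x) + 2 * b (t, x) * h.eq_im (t, x))

theorem hasDerivAt_kinetic (h : IsSchrodingerPair a b W) (t : ℝ) :
    HasDerivAt (fun s => ∫ x, kinetic a b (s, x))
      (-∫ x, W (t, x) * dirD dirT (dens a b) (t, x)) t := by
  have ha := h.rapid_re
  have hb := h.rapid_im
  have has := ha.isSmooth
  have hbs := hb.isSmooth
  have key := (IsRapid.hasDerivAt_integral_of_flux (t := t) (isRapid_kinetic ha hb)
    (F := fun j p => 2 * (dirD (dirX j) a p * dirD dirT a p + dirD (dirX j) b p * dirD dirT b p))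
    (g := fun x => -(W (t, x) * dirD dirT (dens a b) (t, x)))
    (fun j => (((ha.dir _).mul (ha.dir _)).add ((hb.dir _).mul (hb.dir _))).const_mul _)
    fun x => ?_).2
  · rwa [integral_neg] at key
  · unfold kinetic stress dens
    simp (maxDischargeDepth := 20) only [IsSmooth.dirD_mul, IsSmooth.dirD_add,
      IsSmooth.dirD_const_mul, IsSmooth.mul, IsSmooth.add, IsSmooth.dir,
      has, hbs, IsSmooth.dirD_dirT_dirX]
    linear_combination 2 * dirD dirT a (t, x) * h.eq_im (t, x)
      - 2 * dirD dirT b (t, x) * h.eq_re (t, x)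

theorem hasDerivAt_radial (h : IsSchrodingerPair a b W) (t : ℝ) :
    Integrable (fun x => W (t, x) * (3 * dens a b (t, x)
        + (coordX 0 (t, x) * dirD (dirX 0) (dens a b) (t, x)
          + coordX 1 (t, x) * dirD (dirX 1) (dens a b) (t, x)
          + coordX 2 (t, x) * dirD (dirX 2) (dens a b) (t, x)))) ∧
    HasDerivAt (fun s => ∫ x, radial a b (s, x))
      (2 * (∫ x, kinetic a b (t, x)) + ∫ x, W (t, x) * (3 * dens a b (t, x)
        + (coordX 0 (t, x) * dirD (dirX 0) (dens a b) (t, x)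
          + coordX 1 (t, x) * dirD (dirX 1) (dens a b) (t, x)
          + coordX 2 (t, x) * dirD (dirX 2) (dens a b) (t, x)))) t := by
  have ha := h.rapid_re
  have hb := h.rapid_im
  have has := ha.isSmooth
  have hbs := hb.isSmooth
  have hk := isRapid_kinetic ha hb
  have key := (IsRapid.hasDerivAt_integral_of_flux (t := t) (isRapid_radial ha hb)
    (F := fun j p => coordX j p * (a p * dirD dirT b p + (-1) * (b p * dirD dirT a p))
      + (-3) * (a p * dirD (dirX j) a p + b p * dirD (dirX j) b p)
      + (-2) * (coordX 0 p * stress a b 0 j p + coordX 1 p * stress a b 1 j p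
        + coordX 2 p * stress a b 2 j p)
      + coordX j p * kinetic a b p)
    (g := fun x => 2 * kinetic a b (t, x) + W (t, x) * (3 * dens a b (t, x)
        + (coordX 0 (t, x) * dirD (dirX 0) (dens a b) (t, x)
          + coordX 1 (t, x) * dirD (dirX 1) (dens a b) (t, x)
          + coordX 2 (t, x) * dirD (dirX 2) (dens a b) (t, x))))
    (fun j => ?_) fun x => ?_)
  · have hki := (hk.integrable t).const_mul 2
    have hi := key.1.sub hki
    simp only [Pi.sub_def, add_sub_cancel_left] at hi
    refine ⟨hi, key.2.congr_deriv ?_⟩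
    rw [integral_add hki hi, integral_const_mul]
  · have hs := fun k => (isRapid_stress ha hb k j).coordX_mul k
    exact ((((ha.mul (hb.dir _)).add ((hb.mul (ha.dir _)).const_mul _)).coordX_mul j).add
      (((ha.mul (ha.dir _)).add (hb.mul (hb.dir _))).const_mul _)).add
      ((((hs 0).add (hs 1)).add (hs 2)).const_mul _) |>.add (hk.coordX_mul j)
  · unfold radial kinetic stress dens current
    simp (maxDischargeDepth := 20) only [IsSmooth.dirD_mul, IsSmooth.dirD_add,
      IsSmooth.dirD_const_mul, IsSmooth.mul, IsSmooth.add, IsSmooth.const_mul, IsSmooth.dir,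
      has, hbs, IsSmooth.coordX,
      dirD_dirT_coordX, dirD_dirX_coordX, Fin.reduceEq, if_true, if_false,
      IsSmooth.dirD_dirT_dirX, IsSmooth.dirD_one_zero, IsSmooth.dirD_two_zero,
      IsSmooth.dirD_two_one]
    linear_combination (2 * (coordX 0 (t, x) * dirD (dirX 0) b (t, x)
      + coordX 1 (t, x) * dirD (dirX 1) b (t, x) + coordX 2 (t, x) * dirD (dirX 2) b (t, x))
      + 3 * b (t, x)) * h.eq_re (t, x)
      - (2 * (coordX 0 (t, x) * dirD (dirX 0) a (t, x)
      + coordX 1 (t, x) * dirD (dirX 1) a (t, x) + coordX 2 (t, x) * dirD (dirX 2) a (t, x))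
      + 3 * a (t, x)) * h.eq_im (t, x)

end IsSchrodingerPair

namespace IsRapid

variable {f : ℝ × E3 → ℝ}

theorem isWeightBounded (hf : IsRapid f) (t : ℝ) : IsWeightBounded (fun x => f (t, x)) := by
  obtain ⟨C, -, hC⟩ := hf.bound |t|
  exact ⟨hf.continuous_slice t, C, fun x => hC t x le_rfl⟩

theorem hasDerivAt_interaction {v : E3 → ℝ} (hv : Integrable v) (hev : ∀ x, v (-x) = v x)
    (hf : IsRapid f) (t : ℝ) :
    HasDerivAt (fun s => interaction v (fun x => f (s, x)) (fun x => f (s, x)))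
      (2 * interaction v (fun x => f (t, x)) (fun x => dirD dirT f (t, x))) t := by
  obtain ⟨A, hA0, hA⟩ := hf.bound (|t| + 1)
  obtain ⟨B, hB0, hB⟩ := (hf.dir dirT).bound (|t| + 1)
  have hs : ∀ s ∈ Metric.ball t 1, |s| ≤ |t| + 1 := fun s hs => by
    rw [Metric.mem_ball, Real.dist_eq] at hs
    have := abs_sub_abs_le_abs_sub s t
    linarith
  refine _root_.hasDerivAt_interaction (m := fun s x => f (s, x))
    (m' := fun s x => dirD dirT f (s, x)) (C := A + B) hv hev one_pos
    (fun s _ => hf.continuous_slice s) ((hf.dir dirT).continuous_slice t)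
    (fun s _ x => hasDerivAt_time (hf.differentiableAt _)) (fun s h x => ?_) fun s h x => ?_
  · refine (hA s x (hs s h)).trans (mul_le_mul_of_nonneg_right ?_ (weight_pos x).le)
    linarith
  · refine (hB s x (hs s h)).trans (mul_le_mul_of_nonneg_right ?_ (weight_pos x).le)
    linarith

theorem fderiv_slice_self (hf : IsRapid f) (t : ℝ) (x : E3) :
    fderiv ℝ (fun y => f (t, y)) x x = coordX 0 (t, x) * dirD (dirX 0) f (t, x)
      + coordX 1 (t, x) * dirD (dirX 1) f (t, x) + coordX 2 (t, x) * dirD (dirX 2) f (t, x) := by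
  have hx : ((0 : ℝ), x) = coordX 0 (t, x) • dirX 0 + coordX 1 (t, x) • dirX 1
      + coordX 2 (t, x) • dirX 2 := by
    refine Prod.ext (by simp [dirX]) ?_
    ext i
    fin_cases i <;> simp [dirX, coordX]
  rw [(hasFDerivAt_space (hf.differentiableAt _)).fderiv]
  change fderiv ℝ f (t, x) (0, x) = _
  rw [hx]
  simp [dirD]

end IsRapid

/-- The pseudoconformal energy in terms of real and imaginary parts. -/
def conformalEnergy (v : E3 → ℝ) (a b : ℝ × E3 → ℝ) (t : ℝ) : ℝ :=
  (∫ x, moment a b (t, x)) + 4 * t ^ 2 * (∫ x, kinetic a b (t, x))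
    - 4 * t * (∫ x, radial a b (t, x))
    + 2 * t ^ 2 * interaction v (fun x => dens a b (t, x)) (fun x => dens a b (t, x))

/-- The squared length of `(x + 2it∇)(a + ib)`. -/
def conformalGradient (a b : ℝ × E3 → ℝ) (t : ℝ) (x : E3) : ℝ :=
  ∑ j : Fin 3, ((coordX j (t, x) * a (t, x) - 2 * t * dirD (dirX j) b (t, x)) ^ 2
    + (coordX j (t, x) * b (t, x) + 2 * t * dirD (dirX j) a (t, x)) ^ 2)

theorem conformalGradient_nonneg (a b : ℝ × E3 → ℝ) (t : ℝ) (x : E3) :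
    0 ≤ conformalGradient a b t x :=
  Finset.sum_nonneg fun _ _ => by positivity

theorem conformalGradient_eq (a b : ℝ × E3 → ℝ) (t : ℝ) (x : E3) :
    conformalGradient a b t x = moment a b (t, x) + 4 * t ^ 2 * kinetic a b (t, x)
      - 4 * t * radial a b (t, x) := by
  simp only [conformalGradient, Fin.sum_univ_three, moment, kinetic, radial, dens, stress, current]
  ring

theorem integrable_conformalGradient {a b : ℝ × E3 → ℝ} (ha : IsRapid a) (hb : IsRapid b)
    (t : ℝ) : Integrable (conformalGradient a b t) := by
  have h : conformalGradient a b t = fun x => moment a b (t, x) + 4 * t ^ 2 * kinetic a b (t, x)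
      - 4 * t * radial a b (t, x) := funext (conformalGradient_eq a b t)
  rw [h]
  exact (((isRapid_moment ha hb).integrable t).add
    (((isRapid_kinetic ha hb).integrable t).const_mul _)).sub
    (((isRapid_radial ha hb).integrable t).const_mul _)

theorem conformalEnergy_eq (v : E3 → ℝ) {a b : ℝ × E3 → ℝ} (ha : IsRapid a) (hb : IsRapid b)
    (t : ℝ) : conformalEnergy v a b t = (∫ x, conformalGradient a b t x)
      + 2 * t ^ 2 * interaction v (fun x => dens a b (t, x)) (fun x => dens a b (t, x)) := by
  have hm := (isRapid_moment ha hb).integrable t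
  have hk := ((isRapid_kinetic ha hb).integrable t).const_mul (4 * t ^ 2)
  have hr := ((isRapid_radial ha hb).integrable t).const_mul (4 * t)
  simp_rw [conformalGradient_eq]
  have e1 := integral_sub (hm.add hk) hr
  have e2 := integral_add hm hk
  simp only [Pi.add_apply] at e1
  rw [e1, e2, integral_const_mul, integral_const_mul, conformalEnergy]

theorem dens_nonneg (a b : ℝ × E3 → ℝ) (p : ℝ × E3) : 0 ≤ dens a b p :=
  add_nonneg (mul_self_nonneg _) (mul_self_nonneg _)

theorem IsSchrodingerPair.exists_hasDerivAt_conformalEnergy {χ : ℝ → ℝ} {v : E3 → ℝ}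
    (hχ : IsCutoff χ) (hv : ∀ x : E3, x ≠ 0 → v x = χ ‖x‖ / ‖x‖) {a b W : ℝ × E3 → ℝ}
    (h : IsSchrodingerPair a b W)
    (hW : ∀ t x, W (t, x) = ∫ y, v y * dens a b (t, x - y)) {t : ℝ} (ht : 0 ≤ t) :
    ∃ D, HasDerivAt (conformalEnergy v a b) D t ∧
      D ≤ 2 * t * interaction v (fun x => dens a b (t, x)) (fun x => dens a b (t, x)) := by
  have hvi := hχ.integrable_potential hv
  have hn := isRapid_dens h.rapid_re h.rapid_im
  have hnw := hn.isWeightBounded t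
  have hP := hn.hasDerivAt_interaction hvi (IsCutoff.potential_neg hv) t
  have hPW : interaction v (fun x => dens a b (t, x)) (fun x => dirD dirT (dens a b) (t, x))
      = ∫ x, W (t, x) * dirD dirT (dens a b) (t, x) := by
    rw [hnw.interaction_eq hvi ((hn.dir dirT).isWeightBounded t)]
    simp_rw [hW]
  have hrad : IsRapid (fun p => coordX 0 p * dirD (dirX 0) (dens a b) p
      + coordX 1 p * dirD (dirX 1) (dens a b) p + coordX 2 p * dirD (dirX 2) (dens a b) p) := by
    have hc := fun j => (hn.dir (dirX j)).coordX_mul j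
    exact ((hc 0).add (hc 1)).add (hc 2)
  have hvir := interaction_self_le_virial hχ hv (fun x => dens_nonneg a b (t, x))
    (fun x => (hasFDerivAt_space (hn.differentiableAt _)).differentiableAt) hnw (by
      simp_rw [hn.fderiv_slice_self]
      exact hrad.isWeightBounded t)
  simp_rw [hn.fderiv_slice_self] at hvir
  rw [hnw.interaction_eq hvi (((hn.const_mul 3).add hrad).isWeightBounded t)] at hvir
  simp_rw [← hW] at hvir
  have hsq : HasDerivAt (fun s : ℝ => s ^ 2) (2 * t) t := by simpa using hasDerivAt_pow 2 t
  refine ⟨_, (((h.hasDerivAt_moment t).add ((hsq.const_mul 4).mul (h.hasDerivAt_kinetic t))).sub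
    (((hasDerivAt_id t).const_mul 4).mul (h.hasDerivAt_radial t).2)).add
    ((hsq.const_mul 2).mul hP), ?_⟩
  rw [hPW]
  simp only [id]
  nlinarith [mul_le_mul_of_nonneg_left hvir ht]

theorem le_of_hasDerivAt_nonpos {f : ℝ → ℝ} (hf : ∀ t, 1 ≤ t → ∃ D, HasDerivAt f D t ∧ D ≤ 0)
    {t : ℝ} (ht : 1 ≤ t) : f t ≤ f 1 := by
  have hanti : AntitoneOn f (Set.Ici 1) := by
    refine antitoneOn_of_deriv_nonpos (convex_Ici 1) (fun s hs => ?_) (fun s hs => ?_)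
      fun s hs => ?_
    · obtain ⟨D, hD, -⟩ := hf s hs
      exact hD.continuousAt.continuousWithinAt
    · obtain ⟨D, hD, -⟩ := hf s (interior_subset hs)
      exact hD.differentiableAt.differentiableWithinAt
    · obtain ⟨D, hD, hD0⟩ := hf s (interior_subset hs)
      rwa [hD.deriv]
  exact hanti (Set.mem_Ici.2 le_rfl) ht ht

/-- Two passes through the differential inequality for the pseudoconformal energy. -/
theorem exists_le_sqrt_of_energy_inequality {E G P : ℝ → ℝ} {K : ℝ} (hK : 0 ≤ K)
    (hE : ∀ t, 1 ≤ t → ∃ D, HasDerivAt E D t ∧ D ≤ 2 * t * P t)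
    (hEP : ∀ t, E t = G t + 2 * t ^ 2 * P t) (hG : ∀ t, 0 ≤ G t) (hP : ∀ t, 0 ≤ P t)
    (hPG : ∀ t, 1 ≤ t → ∀ c, 0 < c → P t ≤ K * (c + (G t / (4 * t ^ 2)) ^ 3 / c)) :
    ∃ C, 0 ≤ C ∧ ∀ t, 1 ≤ t → G t ≤ C * √t := by
  have hGE : ∀ t, G t ≤ E t := fun t => by
    rw [hEP]
    have := hP t
    have : 0 ≤ 2 * t ^ 2 * P t := by positivity
    linarith
  have hE1 : 0 ≤ E 1 := (hG 1).trans (hGE 1)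
  have first : ∀ t, 1 ≤ t → E t ≤ E 1 * t := by
    intro t ht
    have h := le_of_hasDerivAt_nonpos (f := fun s => E s / s) (fun s hs => ?_) ht
    · simpa using (div_le_iff₀ (by linarith)).1 h
    · obtain ⟨D, hD, hD2⟩ := hE s hs
      have hs0 : 0 < s := by linarith
      refine ⟨_, hD.div (hasDerivAt_id s) hs0.ne', ?_⟩
      refine div_nonpos_of_nonpos_of_nonneg ?_ (sq_nonneg _)
      have h1 := hEP s
      have h2 := hG s
      nlinarith
  set L := K * (1 + (E 1 / 4) ^ 3) with hL
  have hL0 : 0 ≤ L := by positivity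
  have hPs : ∀ t, 1 ≤ t → 2 * t * P t ≤ 4 * L * (1 / (2 * √t)) := by
    intro t ht
    have ht0 : 0 < t := by linarith
    have hr : 0 < √t := Real.sqrt_pos.2 ht0
    have hq : G t / (4 * t ^ 2) ≤ E 1 / 4 / t := by
      rw [div_div, div_le_div_iff₀ (by positivity) (by positivity)]
      nlinarith [(hGE t).trans (first t ht), mul_pos ht0 ht0]
    have h1 := hPG t ht (1 / (t * √t)) (by positivity)
    have h2 : P t ≤ K * (1 / (t * √t) + (E 1 / 4 / t) ^ 3 / (1 / (t * √t))) := by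
      refine h1.trans ?_
      have := hG t
      gcongr
    have h3 : K * (1 / (t * √t) + (E 1 / 4 / t) ^ 3 / (1 / (t * √t))) = L / (t * √t) := by
      have hsq : √t ^ 2 = t := Real.sq_sqrt ht0.le
      rw [hL]
      field_simp
      rw [hsq]
      ring
    rw [h3] at h2
    calc 2 * t * P t ≤ 2 * t * (L / (t * √t)) := by gcongr
      _ = _ := by
        field_simp
        norm_num [mul_comm]
  refine ⟨E 1 + 4 * L, by positivity, fun t ht => (hGE t).trans ?_⟩
  have h := le_of_hasDerivAt_nonpos (f := fun s => E s - 4 * L * √s) (fun s hs => ?_) ht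
  · have : 1 ≤ √t := Real.one_le_sqrt.2 ht
    simp only [Real.sqrt_one] at h
    nlinarith
  · obtain ⟨D, hD, hD2⟩ := hE s hs
    exact ⟨_, hD.sub ((Real.hasDerivAt_sqrt (by linarith)).const_mul _),
      sub_nonpos.2 (hD2.trans (hPs s hs))⟩

/-- Interpolation of the second moment between the first and the third one. -/
theorem integral_sq_le {f : E3 → ℝ} (hf0 : ∀ x, 0 ≤ f x) (h1 : Integrable f)
    (h2 : Integrable (fun x => f x ^ 2)) (h3 : Integrable (fun x => f x ^ 3)) {c : ℝ}
    (hc : 0 < c) : ∫ x, f x ^ 2 ≤ c * (∫ x, f x) + (∫ x, f x ^ 3) / c := by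
  rw [← integral_const_mul, ← integral_div, ← integral_add (h1.const_mul c) (h3.div_const c)]
  refine integral_mono h2 ((h1.const_mul c).add (h3.div_const c)) fun x => ?_
  have : 0 ≤ f x * (f x - c) ^ 2 / c := div_nonneg (mul_nonneg (hf0 x) (sq_nonneg _)) hc.le
  have h : f x * (f x - c) ^ 2 / c = c * f x + f x ^ 3 / c - 2 * f x ^ 2 := by
    field_simp
    ring
  have := sq_nonneg (f x)
  simp only
  linarith

/-- Modulation of a function by the quadratic phase `c|x|²`. -/
def chirp (c : ℝ) (f : E3 → ℂ) (x : E3) : ℂ :=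
  Complex.exp (Complex.I * ((c * ‖x‖ ^ 2 : ℝ) : ℂ)) * f x

theorem norm_chirp (c : ℝ) (f : E3 → ℂ) (x : E3) : ‖chirp c f x‖ = ‖f x‖ := by
  rw [chirp, norm_mul, mul_comm Complex.I, Complex.norm_exp_ofReal_mul_I, one_mul]

theorem contDiff_chirp (c : ℝ) {f : E3 → ℂ} {n : WithTop ℕ∞} (hf : ContDiff ℝ n f) :
    ContDiff ℝ n (chirp c f) := by
  have h1 : ContDiff ℝ n (fun x : E3 => c * ‖x‖ ^ 2) := contDiff_const.mul (contDiff_norm_sq ℝ)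
  exact (contDiff_const.mul (Complex.ofRealCLM.contDiff.comp h1)).cexp.mul hf

theorem norm_fderiv_chirp_single (c : ℝ) {f : E3 → ℂ} {x : E3} (hf : DifferentiableAt ℝ f x)
    (j : Fin 3) :
    ‖fderiv ℝ (chirp c f) x (EuclideanSpace.single j 1)‖
      = ‖fderiv ℝ f x (EuclideanSpace.single j 1) + Complex.I * (2 * c * x j : ℝ) * f x‖ := by
  have h1 : HasFDerivAt (fun x : E3 => c * ‖x‖ ^ 2) (c • (2 • (innerSL ℝ x))) x := by
    simpa using (HasFDerivAt.norm_sq (hasFDerivAt_id x)).const_mul c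
  have h2 := (((Complex.ofRealCLM.hasFDerivAt.comp x h1).const_mul Complex.I).cexp).mul
    hf.hasFDerivAt
  have h3 : HasFDerivAt (chirp c f) _ x := h2
  have h4 : fderiv ℝ (chirp c f) x (EuclideanSpace.single j 1)
      = chirp c (fun y => fderiv ℝ f x (EuclideanSpace.single j 1)
        + Complex.I * (2 * c * x j : ℝ) * f x) x := by
    rw [h3.fderiv]
    simp [chirp, EuclideanSpace.inner_single_right]
    ring
  rw [h4, norm_chirp]

theorem eLpNorm_natCast_eq {f : E3 → ℂ} {m : ℕ} (hm : m ≠ 0) (hf : Continuous f)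
    (hi : Integrable (fun x => ‖f x‖ ^ m)) :
    eLpNorm f m volume = ENNReal.ofReal ((∫ x, ‖f x‖ ^ m) ^ ((m : ℝ)⁻¹)) := by
  have hp : (m : ENNReal) ≠ 0 := by exact_mod_cast hm
  have hmem : MemLp f m volume := by
    rw [← integrable_norm_rpow_iff hf.aestronglyMeasurable hp (by simp)]
    simpa using hi
  rw [hmem.eLpNorm_eq_integral_rpow_norm hp (by simp)]
  simp

section parts

variable {Φ : ℝ × E3 → ℂ}

theorem dirD_clm (L : ℂ →L[ℝ] ℝ) {p : ℝ × E3} (hΦ : DifferentiableAt ℝ Φ p) (e : ℝ × E3) :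
    dirD e (fun q => L (Φ q)) p = L (fderiv ℝ Φ p e) := by
  have h := L.hasFDerivAt.comp p hΦ.hasFDerivAt
  rw [dirD]
  change fderiv ℝ (L ∘ Φ) p e = _
  rw [h.fderiv]
  rfl

theorem contDiff_fderiv_apply (hΦ : ContDiff ℝ (⊤ : ℕ∞) Φ) (e : ℝ × E3) :
    ContDiff ℝ (⊤ : ℕ∞) (fun p => fderiv ℝ Φ p e) :=
  (hΦ.fderiv_right (m := (⊤ : ℕ∞)) (by simp)).clm_apply contDiff_const

theorem dirD_dirD_clm (L : ℂ →L[ℝ] ℝ) (hΦ : ContDiff ℝ (⊤ : ℕ∞) Φ) (e e' : ℝ × E3)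
    (p : ℝ × E3) : dirD e (dirD e' (fun q => L (Φ q))) p
      = L (fderiv ℝ (fun q => fderiv ℝ Φ q e') p e) := by
  have h : dirD e' (fun q => L (Φ q)) = fun q => L (fderiv ℝ Φ q e') :=
    funext fun q => dirD_clm L (hΦ.differentiable (by simp) q) e'
  rw [h, dirD_clm L ((contDiff_fderiv_apply hΦ e').differentiable (by simp) p)]

end parts

/-- The real part of a space-time function. -/
def rePart (φ : ℝ → E3 → ℂ) (p : ℝ × E3) : ℝ := Complex.reCLM (φ p.1 p.2)

/-- The imaginary part of a space-time function. -/
def imPart (φ : ℝ → E3 → ℂ) (p : ℝ × E3) : ℝ := Complex.imCLM (φ p.1 p.2)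

theorem dens_parts (φ : ℝ → E3 → ℂ) (t : ℝ) (x : E3) :
    dens (rePart φ) (imPart φ) (t, x) = ‖φ t x‖ ^ 2 := by
  rw [← Complex.normSq_eq_norm_sq, Complex.normSq_apply]
  rfl

theorem hartreeW_eq (v : E3 → ℝ) (φ : ℝ → E3 → ℂ) (t : ℝ) (x : E3) :
    hartreeW v (φ t) x = ∫ y, v y * dens (rePart φ) (imPart φ) (t, x - y) := by
  simp only [dens_parts]
  rfl

namespace IsHartreeSolution

variable {v : E3 → ℝ} {φ : ℝ → E3 → ℂ}

theorem hasFDerivAt_slice (hφ : IsHartreeSolution v φ) (t : ℝ) (x : E3) :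
    HasFDerivAt (φ t) ((fderiv ℝ (fun p : ℝ × E3 => φ p.1 p.2) (t, x)).comp (.inr ℝ ℝ E3)) x :=
  hasFDerivAt_space (f := fun p : ℝ × E3 => φ p.1 p.2) (hφ.smooth.differentiable (by simp) _)

theorem isRapid_rePart (hφ : IsHartreeSolution v φ) : IsRapid (rePart φ) :=
  .of_clm Complex.reCLM hφ.smooth hφ.decay

theorem isRapid_imPart (hφ : IsHartreeSolution v φ) : IsRapid (imPart φ) :=
  .of_clm Complex.imCLM hφ.smooth hφ.decay

theorem lapC_eq (hφ : IsHartreeSolution v φ) (t : ℝ) (x : E3) :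
    lapC (φ t) x = ∑ j : Fin 3, fderiv ℝ (fun q => fderiv ℝ (fun p : ℝ × E3 => φ p.1 p.2) q
      (dirX j)) (t, x) (dirX j) := by
  refine Finset.sum_congr rfl fun j _ => ?_
  have h : (fun y => fderiv ℝ (φ t) y (EuclideanSpace.single j 1))
      = fun y => fderiv ℝ (fun p : ℝ × E3 => φ p.1 p.2) (t, y) (dirX j) :=
    funext fun y => by rw [(hφ.hasFDerivAt_slice t y).fderiv]; rfl
  rw [h, (hasFDerivAt_space (f := fun q => fderiv ℝ (fun p : ℝ × E3 => φ p.1 p.2) q (dirX j))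
    ((contDiff_fderiv_apply hφ.smooth _).differentiable (by simp) _)).fderiv]
  rfl

theorem isSchrodingerPair (hφ : IsHartreeSolution v φ) :
    IsSchrodingerPair (rePart φ) (imPart φ) (fun p => hartreeW v (φ p.1) p.2) := by
  have hd : Differentiable ℝ (fun p : ℝ × E3 => φ p.1 p.2) := hφ.smooth.differentiable (by simp)
  have key : ∀ p : ℝ × E3, Complex.I * fderiv ℝ (fun p : ℝ × E3 => φ p.1 p.2) p dirT
      + lapC (φ p.1) p.2 - (hartreeW v (φ p.1) p.2 : ℂ) * φ p.1 p.2 = 0 := fun p => by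
    have h := hφ.eqn p.1 p.2
    rwa [(hasDerivAt_time (f := fun p : ℝ × E3 => φ p.1 p.2) (hd _)).deriv] at h
  refine ⟨hφ.isRapid_rePart, hφ.isRapid_imPart, fun p => ?_, fun p => ?_⟩
  · have h := congrArg Complex.im (key p)
    change dirD dirT (fun q => Complex.reCLM (φ q.1 q.2)) p = -(
      dirD _ (dirD _ (fun q => Complex.imCLM (φ q.1 q.2))) p
      + dirD _ (dirD _ (fun q => Complex.imCLM (φ q.1 q.2))) p
      + dirD _ (dirD _ (fun q => Complex.imCLM (φ q.1 q.2))) p) + _ * Complex.imCLM (φ p.1 p.2)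
    rw [dirD_clm Complex.reCLM (hd p), dirD_dirD_clm _ hφ.smooth, dirD_dirD_clm _ hφ.smooth,
      dirD_dirD_clm _ hφ.smooth]
    rw [hφ.lapC_eq, Fin.sum_univ_three] at h
    simp at h ⊢
    linarith
  · have h := congrArg Complex.re (key p)
    change dirD dirT (fun q => Complex.imCLM (φ q.1 q.2)) p = (
      dirD _ (dirD _ (fun q => Complex.reCLM (φ q.1 q.2))) p
      + dirD _ (dirD _ (fun q => Complex.reCLM (φ q.1 q.2))) p
      + dirD _ (dirD _ (fun q => Complex.reCLM (φ q.1 q.2))) p) - _ * Complex.reCLM (φ p.1 p.2)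
    rw [dirD_clm Complex.imCLM (hd p), dirD_dirD_clm _ hφ.smooth, dirD_dirD_clm _ hφ.smooth,
      dirD_dirD_clm _ hφ.smooth]
    rw [hφ.lapC_eq, Fin.sum_univ_three] at h
    simp at h ⊢
    linarith

theorem conformalGradient_parts (hφ : IsHartreeSolution v φ) {t : ℝ} (ht : t ≠ 0) (x : E3) :
    ∑ j : Fin 3, ‖fderiv ℝ (chirp (-(1 / (4 * t))) (φ t)) x (EuclideanSpace.single j 1)‖ ^ 2
      = conformalGradient (rePart φ) (imPart φ) t x / (4 * t ^ 2) := by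
  have hd : Differentiable ℝ (fun p : ℝ × E3 => φ p.1 p.2) := hφ.smooth.differentiable (by simp)
  rw [conformalGradient, Finset.sum_div]
  refine Finset.sum_congr rfl fun j _ => ?_
  rw [norm_fderiv_chirp_single _ (hφ.hasFDerivAt_slice t x).differentiableAt,
    (hφ.hasFDerivAt_slice t x).fderiv]
  have h1 : dirD (dirX j) (rePart φ) (t, x)
      = (fderiv ℝ (fun p : ℝ × E3 => φ p.1 p.2) (t, x) (dirX j)).re :=
    dirD_clm Complex.reCLM (hd _) _
  have h2 : dirD (dirX j) (imPart φ) (t, x)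
      = (fderiv ℝ (fun p : ℝ × E3 => φ p.1 p.2) (t, x) (dirX j)).im :=
    dirD_clm Complex.imCLM (hd _) _
  change ‖fderiv ℝ (fun p : ℝ × E3 => φ p.1 p.2) (t, x) (dirX j) + _‖ ^ 2 = _
  rw [h1, h2, ← Complex.normSq_eq_norm_sq, Complex.normSq_apply]
  simp [rePart, imPart, coordX]
  field_simp
  ring

end IsHartreeSolution

namespace IsHartreeSolution

variable {v : E3 → ℝ} {φ : ℝ → E3 → ℂ}

theorem continuous_slice (hφ : IsHartreeSolution v φ) (t : ℝ) : Continuous (φ t) :=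
  hφ.smooth.continuous.comp (f := fun x : E3 => (t, x)) (by fun_prop)

theorem isRapid_dens_parts (hφ : IsHartreeSolution v φ) :
    IsRapid (dens (rePart φ) (imPart φ)) :=
  isRapid_dens hφ.isRapid_rePart hφ.isRapid_imPart

theorem integrable_norm_sq (hφ : IsHartreeSolution v φ) (t : ℝ) :
    Integrable (fun x => ‖φ t x‖ ^ 2) := by
  simpa only [dens_parts] using hφ.isRapid_dens_parts.integrable t

theorem integrable_norm_pow_four (hφ : IsHartreeSolution v φ) (t : ℝ) :
    Integrable (fun x => (‖φ t x‖ ^ 2) ^ 2) := by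
  have := (hφ.isRapid_dens_parts.mul hφ.isRapid_dens_parts).integrable t
  simpa only [dens_parts, ← sq] using this

theorem integrable_norm_pow_six (hφ : IsHartreeSolution v φ) (t : ℝ) :
    Integrable (fun x => (‖φ t x‖ ^ 2) ^ 3) := by
  have := ((hφ.isRapid_dens_parts.mul hφ.isRapid_dens_parts).mul
    hφ.isRapid_dens_parts).integrable t
  simpa only [dens_parts, ← sq, ← pow_succ] using this

/-- The Sobolev inequality for the modulated profile. -/
theorem exists_eLpNorm_six_le (v : E3 → ℝ) :
    ∃ C, 0 ≤ C ∧ ∀ φ : ℝ → E3 → ℂ, IsHartreeSolution v φ → ∀ t : ℝ, 0 < t →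
      eLpNorm (φ t) 6 volume ≤ ENNReal.ofReal (C *
        ((∫ x, conformalGradient (rePart φ) (imPart φ) t x) / (4 * t ^ 2)) ^ (1 / 2 : ℝ)) := by
  obtain ⟨C, hC0, hC⟩ := _root_.exists_eLpNorm_six_le
  refine ⟨C, hC0, fun φ hφ t ht => ?_⟩
  have hs : ContDiff ℝ 1 (φ t) :=
    (hφ.smooth.comp (f := fun x : E3 => (t, x)) (by fun_prop)).of_le (by simp)
  have hu : ContDiff ℝ 1 (chirp (-(1 / (4 * t))) (φ t)) := contDiff_chirp _ hs
  have h := hC _ hu ?_ ?_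
  · rwa [eLpNorm_congr_norm_ae (.of_forall fun x => norm_chirp _ _ x),
      integral_congr_ae (.of_forall fun x => hφ.conformalGradient_parts ht.ne' x),
      integral_div] at h
  · rw [memLp_two_iff_integrable_sq_norm hu.continuous.aestronglyMeasurable]
    simpa only [norm_chirp] using hφ.integrable_norm_sq t
  · simp_rw [hφ.conformalGradient_parts ht.ne']
    exact (integrable_conformalGradient hφ.isRapid_rePart hφ.isRapid_imPart t).div_const _

theorem eLpNorm_four_eq (hφ : IsHartreeSolution v φ) (t : ℝ) :
    eLpNorm (φ t) 4 volume
      = ENNReal.ofReal ((∫ x, (‖φ t x‖ ^ 2) ^ 2) ^ (1 / 4 : ℝ)) := by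
  have h := hφ.integrable_norm_pow_four t
  simp only [← pow_mul] at h ⊢
  have := eLpNorm_natCast_eq (by norm_num) (hφ.continuous_slice t) h
  simpa using this

theorem eLpNorm_six_eq (hφ : IsHartreeSolution v φ) (t : ℝ) :
    eLpNorm (φ t) 6 volume
      = ENNReal.ofReal ((∫ x, (‖φ t x‖ ^ 2) ^ 3) ^ (1 / 6 : ℝ)) := by
  have h := hφ.integrable_norm_pow_six t
  simp only [← pow_mul] at h ⊢
  have := eLpNorm_natCast_eq (by norm_num) (hφ.continuous_slice t) h
  simpa using this

theorem integral_norm_sq_eq (hφ : IsHartreeSolution v φ) (t : ℝ) :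
    ∫ x, ‖φ t x‖ ^ 2 = ∫ x, ‖φ 0 x‖ ^ 2 := by
  have h := hφ.isSchrodingerPair.hasDerivAt_mass
  simp only [dens_parts] at h
  exact is_const_of_deriv_eq_zero (fun s => (h s).differentiableAt) (fun s => (h s).deriv) t 0

end IsHartreeSolution

/-- Pointwise-in-time decay for the Hartree equation with `v(x) = χ(|x|)/|x|`:
there is `C` (depending on `φ` and `v`) with `‖φ(t)‖_{L⁶} ≤ C t^{−3/4}` and
`‖φ(t)‖_{L⁴} ≤ C t^{−9/16}` for all `t ≥ 1`. -/
theorem pointwise_decay (v : E3 → ℝ) (χ : ℝ → ℝ) (hχ : IsCutoff χ)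
    (hv : ∀ x : E3, x ≠ 0 → v x = χ ‖x‖ / ‖x‖)
    (φ : ℝ → E3 → ℂ) (hφ : IsHartreeSolution v φ) :
    ∃ C : ℝ, ∀ t : ℝ, 1 ≤ t →
      eLpNorm (φ t) 6 volume ≤ ENNReal.ofReal (C * t ^ (-(3:ℝ)/4)) ∧
      eLpNorm (φ t) 4 volume ≤ ENNReal.ofReal (C * t ^ (-(9:ℝ)/16)) := by
  obtain ⟨S, hS0, hS⟩ := IsHartreeSolution.exists_eLpNorm_six_le v
  set G : ℝ → ℝ := fun t => ∫ x, conformalGradient (rePart φ) (imPart φ) t x with hGdef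
  have hG : ∀ t, 0 ≤ G t := fun t => integral_nonneg fun x => conformalGradient_nonneg _ _ t x
  set M := ∫ x, ‖φ 0 x‖ ^ 2 with hM
  have hM0 : 0 ≤ M := integral_nonneg fun x => by positivity
  have hI6 : ∀ t, 0 < t → ∫ x, (‖φ t x‖ ^ 2) ^ 3 ≤ S ^ 6 * (G t / (4 * t ^ 2)) ^ 3 := by
    intro t ht
    have hq : 0 ≤ G t / (4 * t ^ 2) := div_nonneg (hG t) (by positivity)
    have h0 : 0 ≤ ∫ x, (‖φ t x‖ ^ 2) ^ 3 := integral_nonneg fun x => by positivity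
    have h := hS φ hφ t ht
    rw [hφ.eLpNorm_six_eq, ENNReal.ofReal_le_ofReal_iff (by positivity)] at h
    have h6 := pow_le_pow_left₀ (by positivity) h 6
    rw [mul_pow, ← Real.rpow_natCast (_ ^ (1 / 6 : ℝ)), ← Real.rpow_natCast (_ ^ (1 / 2 : ℝ)),
      ← Real.rpow_mul h0, ← Real.rpow_mul hq] at h6
    norm_num at h6
    norm_cast at h6
  have hI4 : ∀ t, 0 < t → ∀ c, 0 < c →
      ∫ x, (‖φ t x‖ ^ 2) ^ 2 ≤ (M + S ^ 6) * (c + (G t / (4 * t ^ 2)) ^ 3 / c) := by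
    intro t ht c hc
    have hq : 0 ≤ G t / (4 * t ^ 2) := div_nonneg (hG t) (by positivity)
    have h := integral_sq_le (fun x => sq_nonneg ‖φ t x‖) (hφ.integrable_norm_sq t)
      (hφ.integrable_norm_pow_four t) (hφ.integrable_norm_pow_six t) hc
    rw [hφ.integral_norm_sq_eq t] at h
    refine h.trans ?_
    calc _ ≤ c * M + S ^ 6 * (G t / (4 * t ^ 2)) ^ 3 / c := by gcongr; exact hI6 t ht
      _ ≤ (c * M + S ^ 6 * (G t / (4 * t ^ 2)) ^ 3 / c)
          + (c * S ^ 6 + M * ((G t / (4 * t ^ 2)) ^ 3 / c)) :=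
        le_add_of_nonneg_right (by positivity)
      _ = _ := by ring
  have hv0 := IsCutoff.ae_potential_nonneg hχ hv
  have hVI : 0 ≤ ∫ x, v x := integral_nonneg_of_ae hv0
  obtain ⟨A, hA0, hA⟩ := exists_le_sqrt_of_energy_inequality (G := G)
    (P := fun t => interaction v (fun x => dens (rePart φ) (imPart φ) (t, x))
      (fun x => dens (rePart φ) (imPart φ) (t, x)))
    (K := (∫ x, v x) * (M + S ^ 6)) (by positivity)
    (fun t ht => hφ.isSchrodingerPair.exists_hasDerivAt_conformalEnergy hχ hv
      (fun s x => hartreeW_eq v φ s x) (by linarith))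
    (fun t => conformalEnergy_eq v hφ.isRapid_rePart hφ.isRapid_imPart t) hG
    (fun t => IsWeightBounded.interaction_self_nonneg hv0 fun x => dens_nonneg _ _ _)
    (fun t ht c hc => by
      refine (IsWeightBounded.interaction_self_le (IsCutoff.integrable_potential hχ hv) hv0
        (hφ.isRapid_dens_parts.isWeightBounded t)).trans ?_
      rw [mul_assoc]
      simp only [dens_parts]
      exact mul_le_mul_of_nonneg_left (hI4 t (by linarith) c hc) hVI)
  have hGt : ∀ t, 1 ≤ t → G t / (4 * t ^ 2) ≤ A * t ^ (-(3:ℝ)/2) := by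
    intro t ht
    have ht0 : 0 < t := by linarith
    have h1 : t ^ (-(3:ℝ)/2) * t ^ 2 = √t := by
      rw [← Real.rpow_natCast t 2, ← Real.rpow_add ht0, Real.sqrt_eq_rpow]
      norm_num
    rw [div_le_iff₀ (by positivity)]
    calc G t ≤ A * √t := hA t ht
      _ ≤ 4 * (A * √t) := le_mul_of_one_le_left (by positivity) (by norm_num)
      _ = _ := by rw [← h1]; ring
  refine ⟨S * A ^ (1 / 2 : ℝ) + ((M + S ^ 6) * (1 + A ^ 3)) ^ (1 / 4 : ℝ), fun t ht => ?_⟩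
  have ht0 : 0 < t := by linarith
  have hq : 0 ≤ G t / (4 * t ^ 2) := div_nonneg (hG t) (by positivity)
  constructor
  · refine (hS φ hφ t ht0).trans (ENNReal.ofReal_le_ofReal ?_)
    calc _ ≤ S * (A * t ^ (-(3:ℝ)/2)) ^ (1 / 2 : ℝ) := by gcongr; exact hGt t ht
      _ = S * A ^ (1 / 2 : ℝ) * t ^ (-(3:ℝ)/4) := by
        rw [Real.mul_rpow hA0 (by positivity), ← Real.rpow_mul ht0.le]
        norm_num
        ring
      _ ≤ _ := by gcongr; exact le_add_of_nonneg_right (by positivity)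
  · rw [hφ.eLpNorm_four_eq]
    refine ENNReal.ofReal_le_ofReal ?_
    have hc : 0 < t ^ (-(9:ℝ)/4) := by positivity
    have h3 : (t ^ (-(3:ℝ)/2)) ^ 3 = t ^ (-(9:ℝ)/4) * t ^ (-(9:ℝ)/4) := by
      rw [← Real.rpow_natCast, ← Real.rpow_mul ht0.le, ← Real.rpow_add ht0]
      norm_num
    have h4 : ∫ x, (‖φ t x‖ ^ 2) ^ 2 ≤ (M + S ^ 6) * (1 + A ^ 3) * t ^ (-(9:ℝ)/4) := by
      refine (hI4 t ht0 _ hc).trans ?_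
      calc _ ≤ (M + S ^ 6) * (t ^ (-(9:ℝ)/4) + (A * t ^ (-(3:ℝ)/2)) ^ 3 / t ^ (-(9:ℝ)/4)) := by
            gcongr
            exact hGt t ht
        _ = _ := by
            rw [mul_pow, h3]
            field_simp
    have h0 : 0 ≤ ∫ x, (‖φ t x‖ ^ 2) ^ 2 := integral_nonneg fun x => by positivity
    calc _ ≤ ((M + S ^ 6) * (1 + A ^ 3) * t ^ (-(9:ℝ)/4)) ^ (1 / 4 : ℝ) := by gcongr
      _ = ((M + S ^ 6) * (1 + A ^ 3)) ^ (1 / 4 : ℝ) * t ^ (-(9:ℝ)/16) := by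
        rw [Real.mul_rpow (by positivity) (by positivity), ← Real.rpow_mul ht0.le]
        norm_num
      _ ≤ _ := by gcongr; exact le_add_of_nonneg_left (by positivity)
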